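/- arXiv:1111.1064 — 2 statements merged into one kernel-verified Lean document; each statement's English description precedes it below -/
import Mathlib

section
/- Every 2-random Turing degree bounds a 1-generic Turing degree. -/
/-
Common framework: oracle (relative) partial computability via codes,
Turing reducibility, the jump, Cantor-space measure, Martin-Löf randomness
and genericity relative to an oracle, Turing functionals.
-/

open scoped ENNReal

namespace TypicalDegree

/-- Codes for partial functions recursive in an oracle (Kleene-style),
    following `Nat.Partrec.Code` with an extra `oracle` constructor. -/
inductive OracleCode : Type
  | zero : OracleCode
  | succ : OracleCode
  | left : OracleCode
  | right : OracleCode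
  | oracle : OracleCode
  | pair : OracleCode → OracleCode → OracleCode
  | comp : OracleCode → OracleCode → OracleCode
  | prec : OracleCode → OracleCode → OracleCode
  | rfind' : OracleCode → OracleCode

/-- Evaluation of an oracle code relative to an oracle `g : ℕ →. ℕ`. -/
def OracleCode.eval (g : ℕ →. ℕ) : OracleCode → ℕ →. ℕ
  | .zero => pure 0
  | .succ => Nat.succ
  | .left => ↑fun n : ℕ => n.unpair.1
  | .right => ↑fun n : ℕ => n.unpair.2
  | .oracle => g
  | .pair cf cg => fun n => Nat.pair <$> OracleCode.eval g cf n <*> OracleCode.eval g cg n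
  | .comp cf cg => fun n => OracleCode.eval g cg n >>= OracleCode.eval g cf
  | .prec cf cg =>
    Nat.unpaired fun a n =>
      n.rec (OracleCode.eval g cf a) fun y IH => do
        let i ← IH
        OracleCode.eval g cg (Nat.pair a (Nat.pair y i))
  | .rfind' cf =>
    Nat.unpaired fun a m =>
      (Nat.rfind fun n => (fun m => m = 0) <$> OracleCode.eval g cf (Nat.pair a (n + m))).map
        (· + m)

/-- An effective injective numbering of oracle codes. -/
def OracleCode.encodeCode : OracleCode → ℕ
  | .zero => 0
  | .succ => 1
  | .left => 2
  | .right => 3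
  | .oracle => 4
  | .pair cf cg => 4 * Nat.pair cf.encodeCode cg.encodeCode + 5
  | .comp cf cg => 4 * Nat.pair cf.encodeCode cg.encodeCode + 6
  | .prec cf cg => 4 * Nat.pair cf.encodeCode cg.encodeCode + 7
  | .rfind' cf => 4 * Nat.pair cf.encodeCode cf.encodeCode + 8

/-- The characteristic (total) oracle of an element of Cantor space. -/
def chi (X : ℕ → Bool) : ℕ →. ℕ := fun n => Part.some (cond (X n) 1 0)

/-- `f` is partial recursive relative to the oracle `g`. -/
def RedIn (f g : ℕ →. ℕ) : Prop := ∃ c : OracleCode, c.eval g = f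

/-- A total function `ℕ → ℕ` viewed as a partial function. -/
def natFun (f : ℕ → ℕ) : ℕ →. ℕ := fun n => Part.some (f n)

/-- Turing reducibility between elements of Cantor space. -/
def TRed (X Y : ℕ → Bool) : Prop := RedIn (chi X) (chi Y)

/-- Turing equivalence. -/
def TEquiv (X Y : ℕ → Bool) : Prop := TRed X Y ∧ TRed Y X

/-- `X` is computable. -/
def ComputableSeq (X : ℕ → Bool) : Prop := TRed X fun _ => false

/-- `f : ℕ → ℕ` is computable. -/
def ComputableFun (f : ℕ → ℕ) : Prop := RedIn (natFun f) (chi fun _ => false)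

/-- The Turing jump of `X`: the halting problem relative to `X`,
    under the numbering `encodeCode`. -/
noncomputable def jump (X : ℕ → Bool) : ℕ → Bool := fun n =>
  @decide (∃ c : OracleCode, c.encodeCode = n ∧ (c.eval (chi X) n).Dom) (Classical.dec _)

/-- `∅'`, the halting problem. -/
noncomputable def zeroJump : ℕ → Bool := jump fun _ => false

/-- `X` extends the finite binary string `σ` (i.e. `σ ⊂ X`). -/
def extendsStr (X : ℕ → Bool) (σ : List Bool) : Prop :=
  ∀ i : Fin σ.length, X i.1 = σ.get i

/-- `⟦V⟧`: the open set of infinite sequences extending some string in `V`. -/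
def openOf (V : Set (List Bool)) : Set (ℕ → Bool) := {X | ∃ σ ∈ V, extendsStr X σ}

/-- The (fair-coin) measure of the open set `⟦V⟧` determined by a set of strings `V`:
    the supremum over `n` of the proportion of length-`n` strings with a prefix in `V`. -/
noncomputable def stringMeasure (V : Set (List Bool)) : ℝ≥0∞ :=
  ⨆ n : ℕ, (Nat.card {f : Fin n → Bool // ∃ σ ∈ V, σ <+: List.ofFn f} : ℝ≥0∞) / 2 ^ n

/-- The fair-coin (Lebesgue) measure on Cantor space, as the outer measure obtained from
    open coverings by sets of strings; it agrees with Lebesgue measure on measurable sets. -/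
noncomputable def cantorMeasure (S : Set (ℕ → Bool)) : ℝ≥0∞ :=
  ⨅ (V : Set (List Bool)) (_ : S ⊆ openOf V), stringMeasure V

/-- `W` is computably enumerable relative to `X`. -/
def CEIn (X : ℕ → Bool) (W : Set (List Bool)) : Prop :=
  ∃ c : OracleCode, ∀ σ : List Bool, σ ∈ W ↔ (c.eval (chi X) (Encodable.encode σ)).Dom

/-- `W` is computably enumerable. -/
def CE (W : Set (List Bool)) : Prop := CEIn (fun _ => false) W

/-- The c.e. set of strings with index `d`. -/
def ceSetOf (d : OracleCode) : Set (List Bool) :=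
  {σ | (d.eval (chi fun _ => false) (Encodable.encode σ)).Dom}

/-- The sequence `V` of sets of strings is uniformly c.e. relative to `X`. -/
def UniformCEIn (X : ℕ → Bool) (V : ℕ → Set (List Bool)) : Prop :=
  ∃ c : OracleCode, ∀ (i : ℕ) (σ : List Bool),
    σ ∈ V i ↔ (c.eval (chi X) (Nat.pair i (Encodable.encode σ))).Dom

/-- A Martin-Löf test relative to `X`. -/
def MLTest (X : ℕ → Bool) (V : ℕ → Set (List Bool)) : Prop :=
  UniformCEIn X V ∧ ∀ i : ℕ, stringMeasure (V i) < (2 : ℝ≥0∞)⁻¹ ^ i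

/-- `Y` is Martin-Löf random relative to `X`. -/
def MLRandomIn (X Y : ℕ → Bool) : Prop :=
  ∀ V : ℕ → Set (List Bool), MLTest X V → ∃ i, Y ∉ openOf (V i)

/-- `Y` is 1-random. -/
def OneRandom (Y : ℕ → Bool) : Prop := MLRandomIn (fun _ => false) Y

/-- `Y` is 2-random: Martin-Löf random relative to `∅'`. -/
def TwoRandom (Y : ℕ → Bool) : Prop := MLRandomIn zeroJump Y

/-- `Y` is weakly 2-random: it avoids every null `Π⁰₂` class
    (every null intersection of a uniformly c.e. sequence of open sets). -/
def Weak2Random (Y : ℕ → Bool) : Prop :=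
  ∀ V : ℕ → Set (List Bool), UniformCEIn (fun _ => false) V →
    cantorMeasure (⋂ i, openOf (V i)) = 0 → Y ∉ ⋂ i, openOf (V i)

/-- `Y` is 1-generic relative to `X`. -/
def OneGenericIn (X Y : ℕ → Bool) : Prop :=
  ∀ W : Set (List Bool), CEIn X W →
    ∃ σ : List Bool, extendsStr Y σ ∧ (σ ∈ W ∨ ∀ τ : List Bool, σ <+: τ → τ ∉ W)

/-- `Y` is 1-generic. -/
def OneGeneric (Y : ℕ → Bool) : Prop := OneGenericIn (fun _ => false) Y

/-- `Y` is 2-generic: 1-generic relative to `∅'`. -/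
def TwoGeneric (Y : ℕ → Bool) : Prop := OneGenericIn zeroJump Y

/-- The Turing functional coded by `c` is total on oracle `X` with value `Y ∈ 2^ω`
    (i.e. `Ψ^X = Y`). -/
def FTotal (c : OracleCode) (X : ℕ → Bool) (Y : ℕ → Bool) : Prop :=
  c.eval (chi X) = chi Y

/-- `Ψ^X ⊇ σ`: the output of the functional `c` on oracle `X` extends the string `σ`. -/
def FExtends (c : OracleCode) (X : ℕ → Bool) (σ : List Bool) : Prop :=
  ∀ i : Fin σ.length, c.eval (chi X) i.1 = Part.some (cond (σ.get i) 1 0)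

/-- `π(Ψ,σ) = μ({X : Ψ^X ⊇ σ})`. -/
noncomputable def piMeasure (c : OracleCode) (σ : List Bool) : ℝ≥0∞ :=
  cantorMeasure {X | FExtends c X σ}

/-- A Turing functional is special if every infinite binary sequence
    in its range is incomputable. -/
def Special (c : OracleCode) : Prop :=
  ∀ X Y : ℕ → Bool, FTotal c X Y → ¬ ComputableSeq Y

/-- The code `c` computes the total function `T` on strings (no oracle). -/
def ComputesFun (c : OracleCode) (T : List Bool → Bool) : Prop :=
  ∀ σ : List Bool, c.eval (chi fun _ => false) (Encodable.encode σ) = Part.some (cond (T σ) 1 0)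

/-- `T` is (the characteristic function of) a tree: closed under prefixes. -/
def IsTree (T : List Bool → Bool) : Prop :=
  ∀ σ τ : List Bool, σ <+: τ → T τ = true → T σ = true

/-- The set of infinite paths through the tree `T`; `Π⁰₁` classes are the
    sets of paths through computable trees. -/
def pathsOf (T : List Bool → Bool) : Set (ℕ → Bool) :=
  {X | ∀ n : ℕ, T (List.ofFn fun i : Fin n => X i.1) = true}

/-- The computable join `X ⊕ Y`. -/
def join (X Y : ℕ → Bool) : ℕ → Bool := fun n =>
  if n % 2 = 0 then X (n / 2) else Y (n / 2)

/-- A finite string used as a (partial) oracle. -/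
def strOracle (τ : List Bool) : ℕ →. ℕ := fun n =>
  if h : n < τ.length then Part.some (cond (τ.get ⟨n, h⟩) 1 0) else Part.none

/-- `Ψ^{τ₀}` and `Ψ^{τ₁}` are incompatible: they give different outputs somewhere. -/
def SplitPair (c : OracleCode) (τ₀ τ₁ : List Bool) : Prop :=
  ∃ (n v₀ v₁ : ℕ), v₀ ∈ c.eval (strOracle τ₀) n ∧ v₁ ∈ c.eval (strOracle τ₁) n ∧ v₀ ≠ v₁

/-- `(U,V)` is a `Ψ`-splitting above `τ`. -/
def SplittingAbove (c : OracleCode) (τ : List Bool) (U V : Finset (List Bool)) : Prop :=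
  (∃ ℓ : ℕ, ∀ σ ∈ U ∪ V, σ.length = ℓ ∧ τ <+: σ) ∧
    ∀ σ₀ ∈ U, ∀ σ₁ ∈ V, SplitPair c σ₀ σ₁

/-- The output sequence `Ψ^X` of the functional `c` on oracle `X`
    (defaults to `false` when not total). -/
noncomputable def outSeq (c : OracleCode) (X : ℕ → Bool) : ℕ → Bool := fun n =>
  @dite _ (∃ Y : ℕ → Bool, FTotal c X Y) (Classical.dec _) (fun h => h.choose n) fun _ => false

/-- `Ψ^X ↾ n`, as a finite string. -/
noncomputable def outStr (c : OracleCode) (X : ℕ → Bool) (n : ℕ) : List Bool :=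
  List.ofFn fun i : Fin n => outSeq c X i.1

/-- The degree of `M` is a minimal Turing degree. -/
def MinimalDeg (M : ℕ → Bool) : Prop :=
  ¬ ComputableSeq M ∧ ∀ Z : ℕ → Bool, TRed Z M → ComputableSeq Z ∨ TRed M Z


/-! ### Computability infrastructure -/

theorem code_of_partrec {f : ℕ →. ℕ} (hf : Nat.Partrec f) :
    ∃ c : OracleCode, ∀ g, c.eval g = f := by
  induction hf with
  | zero => exact ⟨.zero, fun _ => rfl⟩
  | succ => exact ⟨.succ, fun _ => rfl⟩
  | left => exact ⟨.left, fun _ => rfl⟩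
  | right => exact ⟨.right, fun _ => rfl⟩
  | pair _ _ hf hg =>
    obtain ⟨cf, hf⟩ := hf
    obtain ⟨cg, hg⟩ := hg
    exact ⟨.pair cf cg, fun g => by simp only [OracleCode.eval, hf, hg]; rfl⟩
  | comp _ _ hf hg =>
    obtain ⟨cf, hf⟩ := hf
    obtain ⟨cg, hg⟩ := hg
    exact ⟨.comp cf cg, fun g => by simp only [OracleCode.eval, hf, hg]; rfl⟩
  | prec _ _ hf hg =>
    obtain ⟨cf, hf⟩ := hf
    obtain ⟨cg, hg⟩ := hg
    exact ⟨.prec cf cg, fun g => by simp only [OracleCode.eval, hf, hg]; rfl⟩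
  | @rfind f _ hf =>
    obtain ⟨cf, hf⟩ := hf
    refine ⟨.comp (.rfind' cf) (.pair (.pair .left .right) .zero), fun g => ?_⟩
    funext n
    simp only [OracleCode.eval, hf]
    simp [Seq.seq, Nat.unpaired, pure, PFun.pure]
    exact Part.map_id' (fun _ => rfl) _

theorem partrec_of_code (c : OracleCode) :
    Nat.Partrec (c.eval (chi fun _ => false)) := by
  induction c with
  | zero => exact Nat.Partrec.zero
  | succ => exact Nat.Partrec.succ
  | left => exact Nat.Partrec.left
  | right => exact Nat.Partrec.right
  | oracle => exact Nat.Partrec.zero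
  | pair _ _ h1 h2 => exact h1.pair h2
  | comp _ _ h1 h2 => exact h1.comp h2
  | prec _ _ h1 h2 => exact h1.prec h2
  | rfind' _ h => exact h.rfind'

/-- `encodeCode` of a constant code. -/
def constCode : ℕ → OracleCode
  | 0 => .zero
  | n + 1 => .comp .succ (constCode n)

theorem constCode_eval (g : ℕ →. ℕ) (n m : ℕ) : (constCode n).eval g m = Part.some n := by
  induction n with
  | zero => rfl
  | succ n ih =>
    simp only [constCode, OracleCode.eval, ih]
    exact Part.bind_some _ _

theorem constCode_prim : Primrec fun n => (constCode n).encodeCode := by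
  have : Primrec fun n : ℕ => (Nat.rec 0 (fun _ r => 4 * Nat.pair 1 r + 6) n : ℕ) :=
    Primrec.nat_rec₁ 0 (Primrec.nat_add.comp (Primrec.nat_mul.comp (Primrec.const 4)
      (Primrec₂.natPair.comp (Primrec.const 1) Primrec.snd)) (Primrec.const 6))
  refine this.of_eq fun n => ?_
  induction n with
  | zero => rfl
  | succ n ih => simp only [constCode, OracleCode.encodeCode, ← ih]

theorem encodeCode_inj : ∀ c d : OracleCode, c.encodeCode = d.encodeCode → c = d := by
  intro c
  induction c with
  | zero => intro d h; cases d <;> simp [OracleCode.encodeCode] at h ⊢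
  | succ => intro d h; cases d <;> simp [OracleCode.encodeCode] at h ⊢
  | left => intro d h; cases d <;> simp [OracleCode.encodeCode] at h ⊢
  | right => intro d h; cases d <;> simp [OracleCode.encodeCode] at h ⊢
  | oracle => intro d h; cases d <;> simp [OracleCode.encodeCode] at h ⊢
  | pair a b iha ihb =>
    intro d h
    cases d <;> simp only [OracleCode.encodeCode] at h <;> try omega
    obtain ⟨h1, h2⟩ := Nat.pair_eq_pair.1
      (Nat.eq_of_mul_eq_mul_left (by norm_num : 0 < 4) (Nat.add_right_cancel h))
    rw [iha _ h1, ihb _ h2]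
  | comp a b iha ihb =>
    intro d h
    cases d <;> simp only [OracleCode.encodeCode] at h <;> try omega
    obtain ⟨h1, h2⟩ := Nat.pair_eq_pair.1
      (Nat.eq_of_mul_eq_mul_left (by norm_num : 0 < 4) (Nat.add_right_cancel h))
    rw [iha _ h1, ihb _ h2]
  | prec a b iha ihb =>
    intro d h
    cases d <;> simp only [OracleCode.encodeCode] at h <;> try omega
    obtain ⟨h1, h2⟩ := Nat.pair_eq_pair.1
      (Nat.eq_of_mul_eq_mul_left (by norm_num : 0 < 4) (Nat.add_right_cancel h))
    rw [iha _ h1, ihb _ h2]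
  | rfind' a iha =>
    intro d h
    cases d <;> simp only [OracleCode.encodeCode] at h <;> try omega
    obtain ⟨h1, h2⟩ := Nat.pair_eq_pair.1
      (Nat.eq_of_mul_eq_mul_left (by norm_num : 0 < 4) (Nat.add_right_cancel h))
    rw [iha _ h1]

/-- Every c.e. set is many-one reducible to the halting problem. -/
theorem jump_reduce {f : ℕ →. ℕ} (hf : Nat.Partrec f) :
    ∃ h : ℕ → ℕ, Primrec h ∧ ∀ n, zeroJump (h n) = true ↔ (f n).Dom := by
  obtain ⟨c, hc⟩ := code_of_partrec hf
  refine ⟨fun n => (OracleCode.comp c (constCode n)).encodeCode, ?_, fun n => ?_⟩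
  · simp only [OracleCode.encodeCode]
    exact (Primrec.nat_add.comp (Primrec.nat_mul.comp (Primrec.const 4)
      (Primrec₂.natPair.comp (Primrec.const _) constCode_prim)) (Primrec.const 6))
  · have key : ∀ m, (OracleCode.comp c (constCode n)).eval (chi fun _ => false) m = f n := by
      intro m
      simp only [OracleCode.eval, constCode_eval, hc]
      exact Part.bind_some _ _
    simp only [zeroJump, jump, decide_eq_true_eq]
    constructor
    · rintro ⟨d, hd, hdom⟩
      rw [encodeCode_inj _ _ hd, key] at hdom
      exact hdom
    · intro h
      exact ⟨_, rfl, by rw [key]; exact h⟩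

open Nat.Partrec (Code) in
/-- Effective search for extensions in c.e. sets of strings. -/
theorem exists_ext : ∃ ext : ℕ → ℕ → List Bool → Option (List Bool),
    Primrec (fun x : ℕ × ℕ × List Bool => ext x.1 x.2.1 x.2.2) ∧
    (∀ s t e σ τ, s ≤ t → ext s e σ = some τ → ext t e σ = some τ) ∧
    (∀ s e σ τ, ext s e σ = some τ → σ <+: τ) ∧
    ∀ W, CE W → ∃ e, ∀ σ, (∀ s τ, ext s e σ = some τ → τ ∈ W) ∧
      (∀ τ, σ <+: τ → τ ∈ W → ∃ s, ext s e σ ≠ none) := by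
  let T : (ℕ × List Bool) → ℕ → Option (List Bool) := fun x t =>
    (Encodable.decode (α := List Bool × ℕ) t).bind fun y =>
      if y.1.take x.2.length = x.2 ∧
        (Code.evaln y.2 (Denumerable.ofNat Code x.1) (Encodable.encode y.1)).isSome = true
      then some y.1 else none
  have hT : Primrec₂ T := by
    refine Primrec.option_bind (Primrec.decode.comp Primrec.snd) ?_
    refine Primrec.ite (PrimrecPred.and ?_ ?_) ?_ (Primrec.const _)
    · exact Primrec.eq.comp (Primrec.list_take.comp
        (Primrec.list_length.comp (Primrec.snd.comp (Primrec.fst.comp Primrec.fst)))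
        (Primrec.fst.comp Primrec.snd)) (Primrec.snd.comp (Primrec.fst.comp Primrec.fst))
    · refine Primrec.eq.comp (Primrec.option_isSome.comp (Code.primrec_evaln.comp
        (Primrec.pair (Primrec.pair (Primrec.snd.comp Primrec.snd)
          ((Primrec.ofNat Code).comp (Primrec.fst.comp (Primrec.fst.comp Primrec.fst))))
          (Primrec.encode.comp (Primrec.fst.comp Primrec.snd))))) (Primrec.const true)
    · exact Primrec.option_some.comp (Primrec.fst.comp Primrec.snd)
  have hS : Partrec fun x => Nat.rfindOpt (T x) := Partrec.rfindOpt hT.to_comp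
  obtain ⟨c, hc⟩ := Code.exists_code.1 hS
  have hc' : ∀ x : ℕ × List Bool, c.eval (Encodable.encode x)
      = (Nat.rfindOpt (T x)).map Encodable.encode := by
    intro x; rw [hc]; simp
  refine ⟨fun s e σ => (Code.evaln s c (Encodable.encode (e, σ))).bind Encodable.decode,
    ?_, ?_, ?_, ?_⟩
  · exact Primrec.option_bind (Code.primrec_evaln.comp
      (Primrec.pair (Primrec.pair Primrec.fst (Primrec.const c))
        (Primrec.encode.comp Primrec.snd))) (Primrec.decode.comp Primrec.snd)
  · intro s t e σ τ hst h
    rw [Option.bind_eq_some_iff] at h ⊢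
    obtain ⟨a, ha, hb⟩ := h
    exact ⟨a, Code.evaln_mono hst ha, hb⟩
  · intro s e σ τ h
    obtain ⟨a, ha, hb⟩ := Option.bind_eq_some_iff.1 h
    have h1 := Code.evaln_sound ha
    rw [hc'] at h1
    obtain ⟨τ', h2, rfl⟩ := (Part.mem_map_iff _).1 h1
    simp only [Encodable.encodek, Option.some.injEq] at hb
    subst hb
    obtain ⟨t, ht⟩ := Nat.rfindOpt_spec h2
    obtain ⟨y, hy, hyy⟩ := Option.bind_eq_some_iff.1 ht
    split_ifs at hyy with hcond
    simp only [Option.some.injEq] at hyy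
    subst hyy
    rw [List.prefix_iff_eq_take]; exact hcond.1.symm
  · rintro W ⟨w, hw⟩
    obtain ⟨d, hd⟩ := Code.exists_code.1 (partrec_of_code w)
    refine ⟨Encodable.encode d, fun σ => ⟨?_, ?_⟩⟩
    · intro s τ h
      obtain ⟨a, ha, hb⟩ := Option.bind_eq_some_iff.1 h
      have h1 := Code.evaln_sound ha
      rw [hc'] at h1
      obtain ⟨τ', h2, rfl⟩ := (Part.mem_map_iff _).1 h1
      simp only [Encodable.encodek, Option.some.injEq] at hb
      subst hb
      obtain ⟨t, ht⟩ := Nat.rfindOpt_spec h2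
      obtain ⟨y, hy, hyy⟩ := Option.bind_eq_some_iff.1 ht
      split_ifs at hyy with hcond
      simp only [Option.some.injEq] at hyy
      subst hyy
      rw [hw, ← hd]
      obtain ⟨v, hv⟩ := Option.isSome_iff_exists.1 hcond.2
      simp only [Denumerable.ofNat_encode] at hv
      exact Part.dom_iff_mem.2 ⟨v, Code.evaln_sound hv⟩
    · intro τ hτ hτW
      rw [hw, ← hd] at hτW
      obtain ⟨v, hv⟩ := Part.dom_iff_mem.1 hτW
      obtain ⟨b, hb⟩ := Code.evaln_complete.1 hv
      have hdom : (Nat.rfindOpt (T (Encodable.encode d, σ))).Dom := by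
        rw [Nat.rfindOpt_dom]
        refine ⟨Encodable.encode (τ, b), τ, ?_⟩
        simp only [T, Encodable.encodek, Option.bind_some, Denumerable.ofNat_encode]
        rw [if_pos]
        · rfl
        · refine ⟨(List.prefix_iff_eq_take.1 hτ).symm, Option.isSome_iff_exists.2 ⟨v, hb⟩⟩
      obtain ⟨ρ, hρ⟩ := Part.dom_iff_mem.1 hdom
      have : Encodable.encode ρ ∈ c.eval (Encodable.encode (Encodable.encode d, σ)) := by
        rw [hc']; exact Part.mem_map _ hρ
      obtain ⟨s, hs⟩ := Code.evaln_complete.1 this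
      refine ⟨s, ?_⟩
      rw [Option.mem_def] at hs
      simp only at *
      rw [hs]; simp

/-! ### The construction -/

/-- States of the construction: a counter, the current output string, and the list of
all draws made so far (requirement index together with the output string at that moment). -/
abbrev St := ℕ × List Bool × List (ℕ × List Bool)

/-- The draws made for requirement `e`. -/
def origs (e : ℕ) (L : List (ℕ × List Bool)) : List (ℕ × List Bool) :=
  L.filter fun q => q.1 = e

/-- The requirement under consideration does not need attention. -/
def quiet (ext : ℕ → ℕ → List Bool → Option (List Bool)) (s : ℕ) (st : St) : Bool :=
  ((origs st.1.unpair.1 st.2.2).head?.map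
    fun q => (ext s st.1.unpair.1 q.2).isNone).getD false

/-- One step of the construction; `n` is the index of the draw at which we wait. -/
def step (ext : ℕ → ℕ → List Bool → Option (List Bool)) (n s : ℕ) (st : St) : St :=
  if quiet ext s st = true then (st.1 + 1, st.2.1 ++ [false], st.2.2)
  else if (origs st.1.unpair.1 st.2.2).length = n then
    ((ext s st.1.unpair.1 st.2.1).map fun τ =>
      ((st.1 + 1, τ ++ [false], (st.1.unpair.1, st.2.1) :: st.2.2) : St)).getD st
  else (st.1 + 1, st.2.1 ++ [false], (st.1.unpair.1, st.2.1) :: st.2.2)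

/-- The construction. -/
def proc (ext : ℕ → ℕ → List Bool → Option (List Bool)) (N : ℕ → ℕ) : ℕ → St
  | 0 => (0, [], [])
  | s + 1 => step ext (N (proc ext N s).1.unpair.1) s (proc ext N s)

/-- At stage `s` we are waiting for requirement `e`. -/
def Stuck (ext : ℕ → ℕ → List Bool → Option (List Bool)) (N : ℕ → ℕ) (e s : ℕ) : Prop :=
  (proc ext N s).1.unpair.1 = e ∧ quiet ext s (proc ext N s) = false ∧
    (origs e (proc ext N s).2.2).length = N e

/-- At stage `s` we are waiting for requirement `e`, in vain. -/
def Lost (ext : ℕ → ℕ → List Bool → Option (List Bool)) (N : ℕ → ℕ) (e s : ℕ) : Prop :=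
  Stuck ext N e s ∧ ∀ t, ext t e (proc ext N s).2.1 = none

section dynamics

variable {ext : ℕ → ℕ → List Bool → Option (List Bool)}

theorem origs_cons_self (e : ℕ) (σ : List Bool) (L : List (ℕ × List Bool)) :
    origs e ((e, σ) :: L) = (e, σ) :: origs e L := by simp [origs]

theorem origs_cons_ne {e d : ℕ} (h : d ≠ e) (σ : List Bool) (L : List (ℕ × List Bool)) :
    origs e ((d, σ) :: L) = origs e L := by simp [origs, h]

theorem step_cases (n s : ℕ) (st : St) :
    (quiet ext s st = true ∧ step ext n s st = (st.1 + 1, st.2.1 ++ [false], st.2.2)) ∨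
    (quiet ext s st = false ∧ (origs st.1.unpair.1 st.2.2).length = n ∧
      ext s st.1.unpair.1 st.2.1 = none ∧ step ext n s st = st) ∨
    (quiet ext s st = false ∧ (origs st.1.unpair.1 st.2.2).length = n ∧
      ∃ τ, ext s st.1.unpair.1 st.2.1 = some τ ∧
        step ext n s st = (st.1 + 1, τ ++ [false], (st.1.unpair.1, st.2.1) :: st.2.2)) ∨
    (quiet ext s st = false ∧ (origs st.1.unpair.1 st.2.2).length ≠ n ∧
      step ext n s st = (st.1 + 1, st.2.1 ++ [false], (st.1.unpair.1, st.2.1) :: st.2.2)) := by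
  by_cases hq : quiet ext s st = true
  · left; exact ⟨hq, by simp [step, hq]⟩
  · right
    have hq' : quiet ext s st = false := by simpa using hq
    by_cases hl : (origs st.1.unpair.1 st.2.2).length = n
    · cases he : ext s st.1.unpair.1 st.2.1 with
      | none => left; exact ⟨hq', hl, rfl, by simp [step, hq', hl, he]⟩
      | some τ => right; left; exact ⟨hq', hl, τ, rfl, by simp [step, hq', hl, he]⟩
    · right; right; exact ⟨hq', hl, by simp [step, hq', hl]⟩

theorem proc_succ (N : ℕ → ℕ) (s : ℕ) : proc ext N (s + 1) =
    step ext (N (proc ext N s).1.unpair.1) s (proc ext N s) := rfl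

theorem proc_isPre (hpre : ∀ s e σ τ, ext s e σ = some τ → σ <+: τ) (N : ℕ → ℕ)
    {s t : ℕ} (h : s ≤ t) : (proc ext N s).2.1 <+: (proc ext N t).2.1 := by
  induction t, h using Nat.le_induction with
  | base => exact List.prefix_refl _
  | succ t _ ih =>
    refine ih.trans ?_
    rw [proc_succ]
    rcases step_cases (ext := ext) (N (proc ext N t).1.unpair.1) t (proc ext N t) with
      ⟨_, h⟩ | ⟨_, _, _, h⟩ | ⟨_, _, τ, h1, h⟩ | ⟨_, _, h⟩ <;> rw [h]
    · exact List.prefix_append _ _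
    · exact (hpre _ _ _ _ h1).trans (List.prefix_append _ _)
    · exact List.prefix_append _ _

theorem proc_counter (hpre : ∀ s e σ τ, ext s e σ = some τ → σ <+: τ) (N : ℕ → ℕ) (s : ℕ) :
    (proc ext N s).1 ≤ s ∧ (proc ext N s).1 ≤ (proc ext N s).2.1.length := by
  induction s with
  | zero => simp [proc]
  | succ s ih =>
    rw [proc_succ]
    rcases step_cases (ext := ext) (N (proc ext N s).1.unpair.1) s (proc ext N s) with
      ⟨_, h⟩ | ⟨_, _, _, h⟩ | ⟨_, _, τ, h1, h⟩ | ⟨_, _, h⟩ <;> rw [h]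
    · simp; omega
    · omega
    · have := (hpre _ _ _ _ h1).length_le
      simp; omega
    · simp; omega

theorem proc_congr (hpre : ∀ s e σ τ, ext s e σ = some τ → σ <+: τ) {N N' : ℕ → ℕ} {s : ℕ}
    (h : ∀ e, e < s → N e = N' e) : proc ext N s = proc ext N' s := by
  induction s with
  | zero => rfl
  | succ s ih =>
    have h1 := ih fun e he => h e (by omega)
    rw [proc_succ, proc_succ, ← h1, h]
    have := (proc_counter hpre N s).1
    have := Nat.unpair_left_le (proc ext N s).1
    omega

theorem origs_succ (N : ℕ → ℕ) (e s : ℕ) :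
    origs e (proc ext N (s + 1)).2.2 = origs e (proc ext N s).2.2 ∨
    ((proc ext N s).1.unpair.1 = e ∧ quiet ext s (proc ext N s) = false ∧
      origs e (proc ext N (s + 1)).2.2 =
      (e, (proc ext N s).2.1) :: origs e (proc ext N s).2.2) := by
  rw [proc_succ]
  rcases step_cases (ext := ext) (N (proc ext N s).1.unpair.1) s (proc ext N s) with
    ⟨_, h⟩ | ⟨_, _, _, h⟩ | ⟨h0, _, τ, h1, h⟩ | ⟨h0, _, h⟩ <;> rw [h]
  · exact Or.inl rfl
  · exact Or.inl rfl
  · by_cases he : (proc ext N s).1.unpair.1 = e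
    · right; subst he; exact ⟨rfl, h0, origs_cons_self _ _ _⟩
    · left; exact origs_cons_ne he _ _
  · by_cases he : (proc ext N s).1.unpair.1 = e
    · right; subst he; exact ⟨rfl, h0, origs_cons_self _ _ _⟩
    · left; exact origs_cons_ne he _ _

theorem origs_length_mono (N : ℕ → ℕ) (e : ℕ) {s t : ℕ} (h : s ≤ t) :
    (origs e (proc ext N s).2.2).length ≤ (origs e (proc ext N t).2.2).length := by
  induction t, h using Nat.le_induction with
  | base => exact le_rfl
  | succ t _ ih =>
    refine ih.trans ?_
    rcases origs_succ (ext := ext) N e t with h | ⟨_, _, h⟩ <;> rw [h]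
    simp

theorem quiet_mono (hmono : ∀ s t e σ τ, s ≤ t → ext s e σ = some τ → ext t e σ = some τ)
    {s t : ℕ} (hst : s ≤ t) (st : St) (h : quiet ext s st = false) :
    quiet ext t st = false := by
  unfold quiet at *
  cases hh : (origs st.1.unpair.1 st.2.2).head? with
  | none => rfl
  | some q =>
    simp only [hh, Option.map_some, Option.getD_some] at h ⊢
    cases he : ext s st.1.unpair.1 q.2 with
    | none => simp [he] at h
    | some τ => simp [hmono _ _ _ _ _ hst he]

theorem stuck_persist (hmono : ∀ s t e σ τ, s ≤ t → ext s e σ = some τ → ext t e σ = some τ)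
    (N : ℕ → ℕ) (e : ℕ) {s t : ℕ} (hst : s ≤ t) (h : Stuck ext N e s) :
    proc ext N t = proc ext N s ∨ N e < (origs e (proc ext N t).2.2).length := by
  induction t, hst using Nat.le_induction with
  | base => exact Or.inl rfl
  | succ t hst ih =>
    rcases ih with ih | ih
    · obtain ⟨h1, h2, h3⟩ := h
      have hq := quiet_mono hmono hst _ h2
      rw [← ih] at hq h1 h3
      rcases step_cases (ext := ext) (N (proc ext N t).1.unpair.1) t (proc ext N t) with
        ⟨h0, h⟩ | ⟨_, _, _, h⟩ | ⟨h0, _, τ, _, h⟩ | ⟨h0, h4, h⟩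
      · rw [hq] at h0; cases h0
      · left; rw [proc_succ, h, ih]
      · right
        rw [proc_succ, h, h1, origs_cons_self]
        simp [h3]
      · rw [h1] at h4; exact absurd h3 h4
    · right; exact ih.trans_le (origs_length_mono N e (Nat.le_succ t))

theorem lost_unique_aux (hmono : ∀ s t e σ τ, s ≤ t → ext s e σ = some τ → ext t e σ = some τ)
    {N N' : ℕ → ℕ} {e s s' : ℕ} (hN : ∀ d, d ≠ e → N d = N' d)
    (h : Lost ext N e s) (h' : Lost ext N' e s') (hlt : N e < N' e) : False := by
  classical
  have hex : ∃ t, Stuck ext N e t := ⟨s, h.1⟩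
  obtain ⟨t0, ht0, hmin⟩ : ∃ t, Stuck ext N e t ∧ ∀ u, u < t → ¬ Stuck ext N e u :=
    ⟨Nat.find hex, Nat.find_spec hex, fun u hu => Nat.find_min hex hu⟩
  have hs : t0 ≤ s := by
    by_contra hc
    exact hmin s (by omega) h.1
  have heq : ∀ t, t ≤ t0 → proc ext N t = proc ext N' t := by
    intro t
    induction t with
    | zero => intro _; rfl
    | succ t ih =>
      intro ht
      have ih := ih (by omega)
      rw [proc_succ, proc_succ, ← ih]
      by_cases he : (proc ext N t).1.unpair.1 = e
      · have hl : (origs e (proc ext N t).2.2).length ≤ N e := by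
          rw [← ht0.2.2]; exact origs_length_mono N e (by omega)
        cases hq : quiet ext t (proc ext N t) with
        | true => simp [step, hq]
        | false =>
          have hne : (origs e (proc ext N t).2.2).length ≠ N e :=
            fun hc => hmin t (by omega) ⟨he, hq, hc⟩
          have hne' : (origs e (proc ext N t).2.2).length ≠ N' e := by omega
          simp only [step, hq, he]
          simp [hne, hne']
      · rw [hN _ he]
  have hsame : proc ext N s = proc ext N t0 := by
    rcases stuck_persist hmono N e hs ht0 with h1 | h1
    · exact h1
    · have := h.1.2.2; omega
  have hno : ∀ t, ext t e (proc ext N t0).2.1 = none := by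
    intro t; rw [← hsame]; exact h.2 t
  obtain ⟨k1, k2, k3⟩ := ht0
  have hinv : ∀ t, t0 + 1 ≤ t → ∃ r, origs e (proc ext N' t).2.2 = (e, (proc ext N t0).2.1) :: r := by
    intro t ht
    induction t, ht using Nat.le_induction with
    | base =>
      refine ⟨origs e (proc ext N t0).2.2, ?_⟩
      rw [proc_succ, ← heq t0 le_rfl]
      have hne : (origs e (proc ext N t0).2.2).length ≠ N' e := by omega
      rcases step_cases (ext := ext) (N' (proc ext N t0).1.unpair.1) t0 (proc ext N t0) with
        ⟨h0, h⟩ | ⟨_, h4, _, h⟩ | ⟨h0, h4, τ, _, h⟩ | ⟨h0, h4, h⟩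
      · rw [k2] at h0; cases h0
      · rw [k1] at h4; exact absurd h4 hne
      · rw [k1] at h4; exact absurd h4 hne
      · rw [h, k1, origs_cons_self]
    | succ t ht ih =>
      obtain ⟨r, hr⟩ := ih
      rcases origs_succ (ext := ext) N' e t with h1 | ⟨h1, h2, _⟩
      · exact ⟨r, h1.trans hr⟩
      · exfalso
        unfold quiet at h2
        rw [h1, hr] at h2
        simp [hno] at h2
  by_cases hc : s' ≤ t0
  · have := origs_length_mono (ext := ext) N e hc
    have h2 := h'.1.2.2
    rw [← heq s' hc] at h2
    omega
  · obtain ⟨r, hr⟩ := hinv s' (by omega)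
    have h1 := h'.1.1
    have h2 := h'.1.2.1
    unfold quiet at h2
    rw [h1, hr] at h2
    simp [hno] at h2

theorem lost_unique (hmono : ∀ s t e σ τ, s ≤ t → ext s e σ = some τ → ext t e σ = some τ)
    {N N' : ℕ → ℕ} {e s s' : ℕ} (hN : ∀ d, d ≠ e → N d = N' d)
    (h : Lost ext N e s) (h' : Lost ext N' e s') : N e = N' e := by
  rcases lt_trichotomy (N e) (N' e) with h1 | h1 | h1
  · exact (lost_unique_aux hmono hN h h' h1).elim
  · exact h1
  · exact (lost_unique_aux hmono (fun d hd => (hN d hd).symm) h' h h1).elim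

theorem progress (hmono : ∀ s t e σ τ, s ≤ t → ext s e σ = some τ → ext t e σ = some τ)
    {N : ℕ → ℕ} (hno : ∀ e s, ¬ Lost ext N e s) (s : ℕ) :
    ∃ t, s ≤ t ∧ (proc ext N t).1 = (proc ext N s).1 ∧
      (proc ext N (t + 1)).1 = (proc ext N t).1 + 1 := by
  by_contra hc
  push Not at hc
  have hstep : ∀ t, proc ext N (t + 1) = proc ext N t ∨
      (proc ext N (t + 1)).1 = (proc ext N t).1 + 1 := by
    intro t
    rw [proc_succ]
    rcases step_cases (ext := ext) (N (proc ext N t).1.unpair.1) t (proc ext N t) with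
      ⟨_, h⟩ | ⟨_, _, _, h⟩ | ⟨_, _, τ, h1, h⟩ | ⟨_, _, h⟩ <;> rw [h] <;> simp
  have hconst : ∀ t, s ≤ t → proc ext N t = proc ext N s := by
    intro t ht
    induction t, ht using Nat.le_induction with
    | base => rfl
    | succ t ht ih =>
      rcases hstep t with h | h
      · rw [h, ih]
      · exact absurd h (hc t ht (by rw [ih]))
  have hs := hconst (s + 1) (by omega)
  have hs' := hs
  rw [proc_succ] at hs'
  rcases step_cases (ext := ext) (N (proc ext N s).1.unpair.1) s (proc ext N s) with
    ⟨_, h⟩ | ⟨h0, h1, _, h⟩ | ⟨_, _, τ, h1, h⟩ | ⟨_, _, h⟩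
  · rw [h] at hs'; have := congrArg Prod.fst hs'; simp at this
  · have hl := hno (proc ext N s).1.unpair.1 s
    have : ¬ ∀ t, ext t (proc ext N s).1.unpair.1 (proc ext N s).2.1 = none :=
      fun hx => hl ⟨⟨rfl, h0, h1⟩, hx⟩
    push Not at this
    obtain ⟨t, ht⟩ := this
    obtain ⟨τ, hτ⟩ := Option.ne_none_iff_exists'.1 ht
    have hτ' := hmono _ (max s t) _ _ _ (le_max_right _ _) hτ
    have e1 := hconst (max s t) (le_max_left _ _)
    have e2 := hconst (max s t + 1) (by have := le_max_left s t; omega)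
    rw [proc_succ, e1] at e2
    have hq := quiet_mono hmono (le_max_left s t) _ h0
    simp only [step, hq, h1, hτ'] at e2
    have := congrArg Prod.fst e2
    simp at this
  · rw [h] at hs'; have := congrArg Prod.fst hs'; simp at this
  · rw [h] at hs'; have := congrArg Prod.fst hs'; simp at this

theorem visits (hmono : ∀ s t e σ τ, s ≤ t → ext s e σ = some τ → ext t e σ = some τ)
    {N : ℕ → ℕ} (hno : ∀ e s, ¬ Lost ext N e s) (m : ℕ) :
    ∃ t, (proc ext N t).1 = m ∧ (proc ext N (t + 1)).1 = m + 1 := by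
  induction m with
  | zero =>
    obtain ⟨t, _, h1, h2⟩ := progress hmono hno 0
    have h0 : (proc ext N 0).1 = 0 := rfl
    exact ⟨t, by omega, by omega⟩
  | succ m ih =>
    obtain ⟨u, _, hu⟩ := ih
    obtain ⟨t, _, h1, h2⟩ := progress hmono hno (u + 1)
    exact ⟨t, by omega, by omega⟩

theorem origin_isPre (hpre : ∀ s e σ τ, ext s e σ = some τ → σ <+: τ) (N : ℕ → ℕ) (s : ℕ) :
    ∀ q ∈ (proc ext N s).2.2, q.2 <+: (proc ext N s).2.1 := by
  induction s with
  | zero => simp [proc]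
  | succ s ih =>
    have hp := proc_isPre hpre N (Nat.le_succ s)
    have key : ∀ q ∈ (proc ext N (s + 1)).2.2, q.2 <+: (proc ext N s).2.1 := by
      rw [proc_succ]
      rcases step_cases (ext := ext) (N (proc ext N s).1.unpair.1) s (proc ext N s) with
        ⟨_, h⟩ | ⟨_, _, _, h⟩ | ⟨_, _, τ, h1, h⟩ | ⟨_, _, h⟩ <;> rw [h]
      · exact ih
      · exact ih
      · simpa using fun a b h => ih (a, b) h
      · simpa using fun a b h => ih (a, b) h
    exact fun q hq => (key q hq).trans hp

theorem met (hpre : ∀ s e σ τ, ext s e σ = some τ → σ <+: τ) {N : ℕ → ℕ} {W : Set (List Bool)}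
    {e : ℕ} (hW : ∀ σ s τ, ext s e σ = some τ → τ ∈ W) (s : ℕ)
    (h : N e < (origs e (proc ext N s).2.2).length) :
    ∃ τ ∈ W, τ <+: (proc ext N s).2.1 := by
  induction s with
  | zero => simp [proc, origs] at h
  | succ s ih =>
    by_cases hlt : N e < (origs e (proc ext N s).2.2).length
    · obtain ⟨τ, h1, h2⟩ := ih hlt
      exact ⟨τ, h1, h2.trans (proc_isPre hpre N (Nat.le_succ s))⟩
    · rw [proc_succ] at h ⊢
      rcases step_cases (ext := ext) (N (proc ext N s).1.unpair.1) s (proc ext N s) with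
        ⟨_, h'⟩ | ⟨_, _, _, h'⟩ | ⟨_, h0, τ, h1, h'⟩ | ⟨_, h0, h'⟩ <;> rw [h'] at h ⊢
      · exact absurd h hlt
      · exact absurd h hlt
      · by_cases he : (proc ext N s).1.unpair.1 = e
        · rw [he] at h1
          exact ⟨τ, hW _ _ _ h1, List.prefix_append _ _⟩
        · simp only [origs_cons_ne he] at h
          exact absurd h hlt
      · by_cases he : (proc ext N s).1.unpair.1 = e
        · rw [he] at h h0
          simp only [origs_cons_self, List.length_cons] at h
          omega
        · simp only [origs_cons_ne he] at h
          exact absurd h hlt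

theorem generic_aux (hmono : ∀ s t e σ τ, s ≤ t → ext s e σ = some τ → ext t e σ = some τ)
    (hpre : ∀ s e σ τ, ext s e σ = some τ → σ <+: τ)
    {N : ℕ → ℕ} (hno : ∀ e s, ¬ Lost ext N e s) {W : Set (List Bool)}
    {e : ℕ} (hW : ∀ σ s τ, ext s e σ = some τ → τ ∈ W)
    (hW' : ∀ σ τ, σ <+: τ → τ ∈ W → ∃ s, ext s e σ ≠ none) :
    ∃ σ s, σ <+: (proc ext N s).2.1 ∧ (σ ∈ W ∨ ∀ τ, σ <+: τ → τ ∉ W) := by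
  classical
  by_cases hb : ∃ s, N e < (origs e (proc ext N s).2.2).length
  · obtain ⟨s, hs⟩ := hb
    obtain ⟨τ, h1, h2⟩ := met hpre hW s hs
    exact ⟨τ, s, h2, Or.inl h1⟩
  · push Not at hb
    obtain ⟨s1, hs1⟩ : ∃ s1, ∀ s, (origs e (proc ext N s).2.2).length ≤
        (origs e (proc ext N s1).2.2).length := by
      have hex : ∃ m, ∀ s, (origs e (proc ext N s).2.2).length ≤ m := ⟨_, hb⟩
      have hsp := Nat.find_spec hex
      by_contra hc
      push Not at hc
      obtain ⟨u, hu⟩ := hc 0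
      have hu' := hsp u
      refine Nat.find_min hex (m := Nat.find hex - 1) (by omega) fun s => ?_
      obtain ⟨v, hv⟩ := hc s
      have := hsp v
      omega
    have hconst : ∀ t, s1 ≤ t → origs e (proc ext N t).2.2 = origs e (proc ext N s1).2.2 := by
      intro t ht
      induction t, ht using Nat.le_induction with
      | base => rfl
      | succ t ht ih =>
        rcases origs_succ (ext := ext) N e t with h | ⟨_, _, h⟩
        · rw [h, ih]
        · have := hs1 (t + 1)
          rw [h, ih] at this
          simp at this
    have hvisit : ∀ j, s1 ≤ j → ∃ t, j ≤ t ∧ ∃ q, (origs e (proc ext N s1).2.2).head? = some q ∧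
        ext t e q.2 = none := by
      intro j hj
      obtain ⟨t, h1, h2⟩ := visits hmono hno (Nat.pair e j)
      have h3 := (proc_counter hpre N t).1
      have h4 := Nat.right_le_pair e j
      have hjt : j ≤ t := by omega
      have he : (proc ext N t).1.unpair.1 = e := by rw [h1]; simp
      have hq : quiet ext t (proc ext N t) = true := by
        have h5 := hs1 (t + 1)
        rw [← hconst t (by omega)] at h5
        rw [proc_succ] at h2 h5
        rcases step_cases (ext := ext) (N (proc ext N t).1.unpair.1) t (proc ext N t) with
          ⟨h0, _⟩ | ⟨_, _, _, h'⟩ | ⟨_, h0, τ, _, h'⟩ | ⟨_, h0, h'⟩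
        · exact h0
        · rw [h'] at h2; omega
        · rw [h', he, origs_cons_self] at h5; simp at h5
        · rw [h', he, origs_cons_self] at h5; simp at h5
      refine ⟨t, hjt, ?_⟩
      unfold quiet at hq
      rw [he, hconst t (by omega)] at hq
      cases hh : (origs e (proc ext N s1).2.2).head? with
      | none => simp [hh] at hq
      | some q =>
        simp only [hh, Option.map_some, Option.getD_some, Option.isNone_iff_eq_none] at hq
        exact ⟨q, rfl, hq⟩
    obtain ⟨_, _, q, hq, _⟩ := hvisit s1 le_rfl
    have hmem : q ∈ (proc ext N s1).2.2 := by
      have := List.mem_of_head? hq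
      exact List.mem_of_mem_filter this
    refine ⟨q.2, s1, origin_isPre hpre N s1 q hmem, Or.inr fun τ hτ hτW => ?_⟩
    obtain ⟨u, hu⟩ := hW' _ _ hτ hτW
    obtain ⟨ρ, hρ⟩ := Option.ne_none_iff_exists'.1 hu
    obtain ⟨t, ht, q', hq', hn⟩ := hvisit (max s1 u) (le_max_left _ _)
    rw [hq] at hq'
    cases hq'
    have := hmono u t _ _ _ ((le_max_right _ _).trans ht) hρ
    rw [this] at hn
    cases hn

end dynamics

/-! ### Reading the guesses off the oracle -/

/-- The guess for requirement `e` (coded by the first `k + e` bits of the `e`-th column). -/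
def guess (k : ℕ) (X : ℕ → Bool) (e : ℕ) : ℕ :=
  Encodable.encode ((List.range (k + e)).map fun i => X (Nat.pair e i))

/-- A finite string padded with zeros. -/
def pad (τ : List Bool) : ℕ → Bool := fun n => τ.getD n false

theorem guess_congr {k : ℕ} {X Y : ℕ → Bool} {e : ℕ}
    (h : ∀ i, i < k + e → X (Nat.pair e i) = Y (Nat.pair e i)) : guess k X e = guess k Y e := by
  unfold guess
  congr 1
  refine List.map_congr_left fun i hi => h i (List.mem_range.1 hi)

theorem guess_inj {k : ℕ} {X Y : ℕ → Bool} {e : ℕ} (h : guess k X e = guess k Y e) :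
    ∀ i, i < k + e → X (Nat.pair e i) = Y (Nat.pair e i) := by
  intro i hi
  have h1 := Encodable.encode_injective h
  exact List.map_inj_left.1 h1 i (List.mem_range.2 hi)

theorem pair_lt_use {k e i s : ℕ} (he : e ≤ s) (hi : i < k + e) :
    Nat.pair e i < (k + s + 1) ^ 2 := by
  refine (Nat.pair_lt_max_add_one_sq e i).trans_le ?_
  refine Nat.pow_le_pow_left ?_ 2
  have : max e i ≤ k + s := max_le (by omega) (by omega)
  omega

theorem guess_use {k s : ℕ} {X Y : ℕ → Bool} (h : ∀ j, j < (k + s + 1) ^ 2 → X j = Y j)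
    {e : ℕ} (he : e ≤ s) : guess k X e = guess k Y e :=
  guess_congr fun _ hi => h _ (pair_lt_use he hi)

theorem guess_prim : Primrec fun x : (ℕ × List Bool) × ℕ => guess x.1.1 (pad x.1.2) x.2 := by
  unfold guess pad
  refine Primrec.encode.comp (Primrec.list_map (Primrec.list_range.comp
    (Primrec.nat_add.comp (Primrec.fst.comp Primrec.fst) Primrec.snd)) ?_)
  exact (Primrec.list_getD false).comp (Primrec.snd.comp (Primrec.fst.comp Primrec.fst))
    (Primrec₂.natPair.comp (Primrec.snd.comp Primrec.fst) Primrec.snd)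

section prim

variable {ext : ℕ → ℕ → List Bool → Option (List Bool)}

theorem origs_prim : Primrec₂ origs := by
  have hR : PrimrecRel fun (a : ℕ × List Bool) (e : ℕ) => a.1 = e :=
    Primrec.eq.comp (Primrec.fst.comp Primrec.fst) Primrec.snd
  exact (hR.listFilter).comp Primrec.snd Primrec.fst

theorem st_e_prim : Primrec fun st : St => st.1.unpair.1 :=
  Primrec.fst.comp (Primrec.unpair.comp Primrec.fst)

theorem quiet_prim (hext : Primrec (fun x : ℕ × ℕ × List Bool => ext x.1 x.2.1 x.2.2)) :
    Primrec fun x : ℕ × St => quiet ext x.1 x.2 := by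
  unfold quiet
  refine Primrec.option_getD.comp (Primrec.option_map (Primrec.list_head?.comp
    (origs_prim.comp (st_e_prim.comp Primrec.snd)
      (Primrec.snd.comp (Primrec.snd.comp Primrec.snd)))) ?_) (Primrec.const false)
  have h1 : Primrec fun y : (ℕ × St) × (ℕ × List Bool) =>
      (ext y.1.1 y.1.2.1.unpair.1 y.2.2).isSome :=
    Primrec.option_isSome.comp (hext.comp (Primrec.pair (Primrec.fst.comp Primrec.fst)
      (Primrec.pair (st_e_prim.comp (Primrec.snd.comp Primrec.fst))
        (Primrec.snd.comp Primrec.snd))))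
  exact (Primrec.not.comp h1).of_eq fun y => by simp

theorem step_prim (hext : Primrec (fun x : ℕ × ℕ × List Bool => ext x.1 x.2.1 x.2.2)) :
    Primrec fun x : ℕ × ℕ × St => step ext x.1 x.2.1 x.2.2 := by
  have hst : Primrec fun x : ℕ × ℕ × St => x.2.2 := Primrec.snd.comp Primrec.snd
  have hp : Primrec fun x : ℕ × ℕ × St => x.2.2.1 + 1 :=
    Primrec.succ.comp (Primrec.fst.comp hst)
  have hσ : Primrec fun x : ℕ × ℕ × St => x.2.2.2.1 :=
    Primrec.fst.comp (Primrec.snd.comp hst)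
  have hL : Primrec fun x : ℕ × ℕ × St => x.2.2.2.2 :=
    Primrec.snd.comp (Primrec.snd.comp hst)
  have he : Primrec fun x : ℕ × ℕ × St => x.2.2.1.unpair.1 := st_e_prim.comp hst
  have hcons : Primrec fun x : ℕ × ℕ × St => (x.2.2.1.unpair.1, x.2.2.2.1) :: x.2.2.2.2 :=
    Primrec.list_cons.comp (Primrec.pair he hσ) hL
  have hσ' : Primrec fun x : ℕ × ℕ × St => x.2.2.2.1 ++ [false] :=
    Primrec.list_concat.comp hσ (Primrec.const false)
  unfold step
  refine Primrec.ite (Primrec.eq.comp ((quiet_prim hext).comp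
    (Primrec.pair (Primrec.fst.comp Primrec.snd) hst)) (Primrec.const true))
    (Primrec.pair hp (Primrec.pair hσ' hL)) ?_
  refine Primrec.ite (Primrec.eq.comp (Primrec.list_length.comp (origs_prim.comp he hL))
    Primrec.fst) ?_ (Primrec.pair hp (Primrec.pair hσ' hcons))
  refine Primrec.option_getD.comp (Primrec.option_map (hext.comp (Primrec.pair
    (Primrec.fst.comp Primrec.snd) (Primrec.pair he hσ))) ?_) hst
  exact Primrec.pair (hp.comp Primrec.fst) (Primrec.pair
    (Primrec.list_concat.comp Primrec.snd (Primrec.const false)) (hcons.comp Primrec.fst))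

section sealedDefs

attribute [local irreducible] step quiet guess

theorem proc_prim (hext : Primrec (fun x : ℕ × ℕ × List Bool => ext x.1 x.2.1 x.2.2)) :
    Primrec fun x : (ℕ × List Bool) × ℕ => proc ext (guess x.1.1 (pad x.1.2)) x.2 := by
  have h : Primrec fun x : (ℕ × List Bool) × ℕ =>
      (Nat.rec ((0, [], []) : St) (fun s st => step ext (guess x.1.1 (pad x.1.2) st.1.unpair.1) s st)
        x.2 : St) := by
    refine Primrec.nat_rec' (h := fun (x : (ℕ × List Bool) × ℕ) (y : ℕ × St) =>
      step ext (guess x.1.1 (pad x.1.2) y.2.1.unpair.1) y.1 y.2)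
      Primrec.snd (Primrec.const ((0, [], []) : St)) ?_
    have h1 : Primrec fun z : ((ℕ × List Bool) × ℕ) × (ℕ × St) => (z.1.1, z.2.2.1.unpair.1) :=
      Primrec.pair (Primrec.fst.comp Primrec.fst) (st_e_prim.comp (Primrec.snd.comp Primrec.snd))
    have h2 : Primrec fun z : ((ℕ × List Bool) × ℕ) × (ℕ × St) =>
        guess z.1.1.1 (pad z.1.1.2) z.2.2.1.unpair.1 := guess_prim.comp h1
    have h3 : Primrec fun z : ((ℕ × List Bool) × ℕ) × (ℕ × St) =>
        (guess z.1.1.1 (pad z.1.1.2) z.2.2.1.unpair.1, z.2.1, z.2.2) :=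
      Primrec.pair h2 Primrec.snd
    exact (step_prim hext).comp h3
  refine h.of_eq fun x => ?_
  obtain ⟨x, s⟩ := x
  induction s with
  | zero => rfl
  | succ s ih =>
    simp only at ih ⊢
    rw [proc_succ, ← ih]

end sealedDefs

end prim

theorem eval_pair' {g : ℕ →. ℕ} {cf cg : OracleCode} {n a b : ℕ}
    (h1 : cf.eval g n = Part.some a) (h2 : cg.eval g n = Part.some b) :
    (OracleCode.pair cf cg).eval g n = Part.some (Nat.pair a b) := by
  simp [OracleCode.eval, h1, h2, Seq.seq]

theorem eval_comp' {g : ℕ →. ℕ} {cf cg : OracleCode} {n a : ℕ}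
    (h1 : cg.eval g n = Part.some a) :
    (OracleCode.comp cf cg).eval g n = cf.eval g a := by
  simp only [OracleCode.eval, h1]
  exact Part.bind_some _ _

theorem code_of_prim {f : ℕ → ℕ} (hf : Primrec f) :
    ∃ c : OracleCode, ∀ g n, c.eval g n = Part.some (f n) := by
  obtain ⟨c, hc⟩ := code_of_partrec (Partrec.nat_iff.1 hf.to_comp)
  exact ⟨c, fun g n => by rw [hc]; rfl⟩

theorem prefix_code : ∃ c : OracleCode, ∀ X n,
    c.eval (chi X) n = Part.some (Encodable.encode ((List.range n).map X)) := by
  obtain ⟨c1, hc1⟩ := code_of_prim (f := fun m => Encodable.encode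
    (((Encodable.decode m.unpair.2 : Option (List Bool)).getD []) ++ [m.unpair.1 == 1])) (by
      refine Primrec.encode.comp (Primrec.list_concat.comp (Primrec.option_getD.comp
        (Primrec.decode.comp (Primrec.snd.comp Primrec.unpair)) (Primrec.const [])) ?_)
      exact Primrec.beq.comp (Primrec.fst.comp Primrec.unpair) (Primrec.const 1))
  obtain ⟨c2, hc2⟩ := code_of_prim (f := fun m => Nat.pair 0 m)
    (Primrec₂.natPair.comp (Primrec.const 0) Primrec.id)
  refine ⟨.comp (.prec .zero (.comp c1 (.pair (.comp .oracle (.comp .left .right))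
    (.comp .right .right)))) c2, fun X n => ?_⟩
  rw [eval_comp' (hc2 _ _)]
  simp only [OracleCode.eval.eq_8, Nat.unpaired, Nat.unpair_pair]
  induction n with
  | zero => rfl
  | succ n ih =>
    simp only
    rw [ih]
    refine (Part.bind_some _ _).trans ?_
    have hr : OracleCode.right.eval (chi X) (Nat.pair 0 (Nat.pair n
      (Encodable.encode ((List.range n).map X)))) = Part.some (Nat.pair n
      (Encodable.encode ((List.range n).map X))) := by simp [OracleCode.eval]
    have h1 : (OracleCode.comp .right .right).eval (chi X) (Nat.pair 0 (Nat.pair n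
      (Encodable.encode ((List.range n).map X)))) = Part.some
      (Encodable.encode ((List.range n).map X)) := by
        rw [eval_comp' hr]; simp [OracleCode.eval]
    have h2 : (OracleCode.comp .left .right).eval (chi X) (Nat.pair 0 (Nat.pair n
      (Encodable.encode ((List.range n).map X)))) = Part.some n := by
        rw [eval_comp' hr]; simp [OracleCode.eval]
    have h3 : (OracleCode.comp .oracle (.comp .left .right)).eval (chi X) (Nat.pair 0 (Nat.pair n
      (Encodable.encode ((List.range n).map X)))) = Part.some (cond (X n) 1 0) := by
        rw [eval_comp' h2]; simp [OracleCode.eval, chi]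
    rw [eval_comp' (eval_pair' h3 h1), hc1]
    cases hX : X n <;> simp [List.range_succ, hX]

theorem pad_isPre (X : ℕ → Bool) (n j : ℕ) (hj : j < n) :
    pad ((List.range n).map X) j = X j := by
  simp [pad, hj]

theorem functional {ext : ℕ → ℕ → List Bool → Option (List Bool)}
    (hext : Primrec (fun x : ℕ × ℕ × List Bool => ext x.1 x.2.1 x.2.2))
    (hpre : ∀ s e σ τ, ext s e σ = some τ → σ <+: τ)
    (k : ℕ) (A G : ℕ → Bool)
    (hdef : ∀ n : ℕ, ∃ s, (proc ext (guess k A) s).2.1[n]? ≠ none)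
    (hG : ∀ (n : ℕ) s b, (proc ext (guess k A) s).2.1[n]? = some b → b = G n) : TRed G A := by
  classical
  obtain ⟨cp, hcp⟩ := prefix_code
  let Q : ℕ → Option Bool := fun m =>
    (proc ext (guess k (pad (((Encodable.decode m.unpair.2 : Option (List Bool))).getD [])))
      m.unpair.1.unpair.2).2.1[m.unpair.1.unpair.1]?
  have hQ : Primrec Q := by
    have a1 : Primrec fun m : ℕ => m.unpair.1.unpair :=
      Primrec.unpair.comp (Primrec.fst.comp Primrec.unpair)
    refine Primrec.list_getElem?.comp (Primrec.fst.comp (Primrec.snd.comp ((proc_prim hext).comp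
      (Primrec.pair (Primrec.pair (Primrec.const k) (Primrec.option_getD.comp
        (Primrec.decode.comp (Primrec.snd.comp Primrec.unpair)) (Primrec.const [])))
        (Primrec.snd.comp a1))))) (Primrec.fst.comp a1)
  obtain ⟨cZ, hcZ⟩ := code_of_prim (f := fun m => cond (Q m).isSome 0 1)
    (Primrec.cond (Primrec.option_isSome.comp hQ) (Primrec.const 0) (Primrec.const 1))
  obtain ⟨cV, hcV⟩ := code_of_prim (f := fun m => cond ((Q m).getD false) 1 0)
    (Primrec.cond (Primrec.option_getD.comp hQ (Primrec.const false))
      (Primrec.const 1) (Primrec.const 0))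
  obtain ⟨cu, hcu⟩ := code_of_prim (f := fun x => (k + x.unpair.2 + 1) * (k + x.unpair.2 + 1)) (by
    have : Primrec fun x : ℕ => k + x.unpair.2 + 1 := Primrec.succ.comp
      (Primrec.nat_add.comp (Primrec.const k) (Primrec.snd.comp Primrec.unpair))
    exact Primrec.nat_mul.comp this this)
  obtain ⟨ci, hci⟩ := code_of_prim (f := fun x => x) Primrec.id
  obtain ⟨cz, hcz⟩ := code_of_prim (f := fun x => Nat.pair x 0)
    (Primrec₂.natPair.comp Primrec.id (Primrec.const 0))
  let u : ℕ → ℕ := fun s => (k + s + 1) * (k + s + 1)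
  let cin : OracleCode := .pair ci (.comp cp cu)
  have hin : ∀ n s : ℕ, cin.eval (chi A) (Nat.pair n s) = Part.some (Nat.pair (Nat.pair n s)
      (Encodable.encode ((List.range (u s)).map A))) := by
    intro n s
    refine eval_pair' (hci _ _) ?_
    rw [eval_comp' (hcu _ _), hcp]
    simp [u]
  have hQv : ∀ n s : ℕ, Q (Nat.pair (Nat.pair n s) (Encodable.encode ((List.range (u s)).map A)))
      = (proc ext (guess k A) s).2.1[n]? := by
    intro n s
    simp only [Q, Nat.unpair_pair, Encodable.encodek, Option.getD_some]
    rw [proc_congr hpre (N' := guess k A) (s := s)]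
    intro e he
    refine guess_use (s := s) (fun j hj => pad_isPre _ _ _ ?_) he.le
    simp only [u]; rwa [← pow_two]
  have hZ : ∀ n s : ℕ, (OracleCode.comp cZ cin).eval (chi A) (Nat.pair n s)
      = Part.some (cond ((proc ext (guess k A) s).2.1[n]?).isSome 0 1) := by
    intro n s
    rw [eval_comp' (hin n s), hcZ, hQv]
  have hV : ∀ n s : ℕ, (OracleCode.comp cV cin).eval (chi A) (Nat.pair n s)
      = Part.some (cond (((proc ext (guess k A) s).2.1[n]?).getD false) 1 0) := by
    intro n s
    rw [eval_comp' (hin n s), hcV, hQv]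
  have hsearch : ∀ n : ℕ, ∃ s, ((proc ext (guess k A) s).2.1[n]?) ≠ none ∧
      (OracleCode.comp (.rfind' (.comp cZ cin)) cz).eval (chi A) n = Part.some s := by
    intro n
    refine ⟨Nat.find (hdef n), Nat.find_spec (hdef n), ?_⟩
    rw [eval_comp' (hcz _ _), OracleCode.eval.eq_9, Part.eq_some_iff]
    simp only [Nat.unpaired, Nat.unpair_pair, Part.mem_map_iff]
    refine ⟨Nat.find (hdef n), ?_, rfl⟩
    refine Nat.mem_rfind.2 ?_
    constructor
    · simp only [Nat.add_zero, hZ]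
      have := Option.isSome_iff_ne_none.2 (Nat.find_spec (hdef n))
      simp only [this]
      simp
    · intro m hm
      have := Nat.find_min (hdef n) hm
      simp only [Nat.add_zero, hZ]
      have h' : ((proc ext (guess k A) m).2.1[n]?) = none := by
        by_contra hc; exact this hc
      simp only [h']
      simp
  refine ⟨.comp (.comp cV cin) (.pair ci (.comp (.rfind' (.comp cZ cin)) cz)), ?_⟩
  funext n
  obtain ⟨s, hs, hs'⟩ := hsearch n
  rw [eval_comp' (eval_pair' (hci _ _) hs'), hV]
  obtain ⟨b, hb⟩ := Option.ne_none_iff_exists'.1 hs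
  rw [hb, Option.getD_some, hG n s b hb]
  rfl

/-- The strings witnessing that the construction gets lost. -/
def badSet (ext : ℕ → ℕ → List Bool → Option (List Bool)) (k : ℕ) : Set (List Bool) :=
  {τ | k + 1 ≤ τ.length.sqrt ∧
    ∃ e, Lost ext (guess k (pad τ)) e (τ.length.sqrt - (k + 1))}

section sealedDefs

attribute [local irreducible] quiet guess origs proc

theorem badSet_ce {ext : ℕ → ℕ → List Bool → Option (List Bool)}
    (hext : Primrec (fun x : ℕ × ℕ × List Bool => ext x.1 x.2.1 x.2.2)) :
    UniformCEIn zeroJump fun i => badSet ext (i + 2) := by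
  obtain ⟨h, hh, hj⟩ := jump_reduce (f := fun m => Nat.rfindOpt fun t =>
      (ext t m.unpair.1 ((Encodable.decode m.unpair.2 : Option (List Bool)).getD [])).map
        fun _ => 0) (by
    refine Partrec.nat_iff.1 (Partrec.rfindOpt (Primrec.to_comp ?_))
    refine Primrec.option_map (hext.comp (Primrec.pair Primrec.snd (Primrec.pair
      (Primrec.fst.comp (Primrec.unpair.comp Primrec.fst)) (Primrec.option_getD.comp
        (Primrec.decode.comp (Primrec.snd.comp (Primrec.unpair.comp Primrec.fst)))
        (Primrec.const []))))) (Primrec.const 0))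
  have hj' : ∀ e σ, zeroJump (h (Nat.pair e (Encodable.encode σ))) = false ↔
      ∀ t, ext t e σ = none := by
    intro e σ
    rw [← Bool.not_eq_true, hj, Nat.rfindOpt_dom]
    simp only [Nat.unpair_pair, Encodable.encodek, Option.getD_some]
    constructor
    · intro h1 t
      by_contra hc
      obtain ⟨τ, hτ⟩ := Option.ne_none_iff_exists'.1 hc
      exact h1 ⟨t, 0, by simp [hτ]⟩
    · rintro h1 ⟨t, a, ha⟩
      simp [h1] at ha
  -- the state reached by a string
  obtain ⟨S, hSdef⟩ : ∃ S : ℕ × List Bool → St, S = fun x =>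
    proc ext (guess x.1 (pad x.2)) (x.2.length.sqrt - (x.1 + 1)) := ⟨_, rfl⟩
  obtain ⟨D, hDdef⟩ : ∃ D : ℕ × List Bool → Option ℕ, D = fun x =>
    if x.1 + 1 ≤ x.2.length.sqrt ∧ quiet ext (x.2.length.sqrt - (x.1 + 1)) (S x) = false ∧
      (origs (S x).1.unpair.1 (S x).2.2).length = guess x.1 (pad x.2) (S x).1.unpair.1
    then some (h (Nat.pair (S x).1.unpair.1 (Encodable.encode (S x).2.1))) else none := ⟨_, rfl⟩
  have hlen : Primrec fun x : ℕ × List Bool => x.2.length.sqrt :=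
    Primrec.nat_sqrt.comp (Primrec.list_length.comp Primrec.snd)
  have htime : Primrec fun x : ℕ × List Bool => x.2.length.sqrt - (x.1 + 1) :=
    Primrec.nat_sub.comp hlen (Primrec.succ.comp Primrec.fst)
  have hS : Primrec S := hSdef ▸ (proc_prim hext).comp (Primrec.pair Primrec.id htime)
  have hD : Primrec D := by
    have he : Primrec fun x => (S x).1.unpair.1 := st_e_prim.comp hS
    have hLL : Primrec fun x => (S x).2.2 := Primrec.snd.comp (Primrec.snd.comp hS)
    have q1 : PrimrecPred fun x : ℕ × List Bool => x.1 + 1 ≤ x.2.length.sqrt :=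
      Primrec.nat_le.comp (Primrec.succ.comp Primrec.fst) hlen
    have q2' : Primrec fun x : ℕ × List Bool => quiet ext (x.2.length.sqrt - (x.1 + 1)) (S x) :=
      (quiet_prim hext).comp (Primrec.pair htime hS)
    have q2 : PrimrecPred fun x : ℕ × List Bool =>
        quiet ext (x.2.length.sqrt - (x.1 + 1)) (S x) = false :=
      Primrec.eq.comp q2' (Primrec.const false)
    have q3' : Primrec fun x : ℕ × List Bool => guess x.1 (pad x.2) (S x).1.unpair.1 :=
by
      have h1 : Primrec fun x : ℕ × List Bool => (x, (S x).1.unpair.1) := Primrec.pair Primrec.id he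
      exact guess_prim.comp h1
    have q3l : Primrec fun x => (origs (S x).1.unpair.1 (S x).2.2).length :=
      Primrec.list_length.comp (origs_prim.comp he hLL)
    have q3 : PrimrecPred fun x : ℕ × List Bool =>
        (origs (S x).1.unpair.1 (S x).2.2).length = guess x.1 (pad x.2) (S x).1.unpair.1 :=
      Primrec.eq.comp q3l q3'
    have hv : Primrec fun x => some (h (Nat.pair (S x).1.unpair.1 (Encodable.encode (S x).2.1))) :=
      Primrec.option_some.comp (hh.comp (Primrec₂.natPair.comp he
        (Primrec.encode.comp (Primrec.fst.comp (Primrec.snd.comp hS)))))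
    rw [hDdef]
    exact Primrec.ite (q1.and (q2.and q3)) hv (Primrec.const none)
  obtain ⟨c1, hc1⟩ := code_of_partrec (f := fun m => ((D (m.unpair.1 + 2,
      (Encodable.decode m.unpair.2 : Option (List Bool)).getD []) : Option ℕ) : Part ℕ)) (by
    refine Partrec.nat_iff.1 (Computable.ofOption (Primrec.to_comp ?_))
    refine hD.comp (Primrec.pair (Primrec.nat_add.comp (Primrec.fst.comp Primrec.unpair)
      (Primrec.const 2)) (Primrec.option_getD.comp
        (Primrec.decode.comp (Primrec.snd.comp Primrec.unpair)) (Primrec.const []))))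
  obtain ⟨c2, hc2⟩ := code_of_partrec (f := fun m =>
      ((if m = 0 then some 0 else none : Option ℕ) : Part ℕ)) (by
    refine Partrec.nat_iff.1 (Computable.ofOption (Primrec.to_comp ?_))
    exact Primrec.ite (Primrec.eq.comp Primrec.id (Primrec.const 0)) (Primrec.const _)
      (Primrec.const _))
  refine ⟨.comp c2 (.comp .oracle c1), fun i τ => ?_⟩
  have hev : c1.eval (chi zeroJump) (Nat.pair i (Encodable.encode τ)) = (D (i + 2, τ) : Part ℕ) := by
    rw [hc1]; simp
  have hSv : S (i + 2, τ) = proc ext (guess (i + 2) (pad τ)) (τ.length.sqrt - ((i + 2) + 1)) := by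
    rw [hSdef]
  by_cases hcond : (i + 2) + 1 ≤ τ.length.sqrt ∧
      quiet ext (τ.length.sqrt - ((i + 2) + 1)) (S (i + 2, τ)) = false ∧
      (origs (S (i + 2, τ)).1.unpair.1 (S (i + 2, τ)).2.2).length
        = guess (i + 2) (pad τ) (S (i + 2, τ)).1.unpair.1
  · have hDv : D (i + 2, τ) = some (h (Nat.pair (S (i + 2, τ)).1.unpair.1
        (Encodable.encode (S (i + 2, τ)).2.1))) := by
      rw [hDdef]; exact if_pos hcond
    rw [hDv] at hev
    rw [eval_comp' (a := cond (zeroJump (h (Nat.pair (S (i + 2, τ)).1.unpair.1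
        (Encodable.encode (S (i + 2, τ)).2.1)))) 1 0) (by
          rw [eval_comp' (by rw [hev]; rfl)]; rfl), hc2]
    cases hz : zeroJump (h (Nat.pair (S (i + 2, τ)).1.unpair.1
        (Encodable.encode (S (i + 2, τ)).2.1))) with
    | false =>
      simp only [cond_false, if_true]
      refine ⟨fun _ => trivial, fun _ => ?_⟩
      rw [hSv] at hcond hz
      exact ⟨hcond.1, _, ⟨rfl, hcond.2.1, hcond.2.2⟩, (hj' _ _).1 hz⟩
    | true =>
      simp only [cond_true]
      refine ⟨?_, fun hx => by simp at hx⟩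
      rintro ⟨_, e, ⟨rfl, _, _⟩, hl⟩
      have := (hj' _ _).2 hl
      rw [hSv, this] at hz
      cases hz
  · have hDv : D (i + 2, τ) = none := by
      rw [hDdef]; exact if_neg hcond
    rw [hDv] at hev
    constructor
    · rintro ⟨h1, e, ⟨rfl, h2, h3⟩, _⟩
      rw [hSv] at hcond
      exact absurd ⟨h1, h2, h3⟩ hcond
    · intro hx
      simp only [OracleCode.eval, hev] at hx
      obtain ⟨⟨h0, _⟩, _⟩ := hx
      exact absurd h0 (by simp)

end sealedDefs

/-! ### The measure of the bad set -/

theorem lost_le {ext : ℕ → ℕ → List Bool → Option (List Bool)}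
    (hpre : ∀ s e σ τ, ext s e σ = some τ → σ <+: τ) {N : ℕ → ℕ} {e s : ℕ}
    (h : Lost ext N e s) : e ≤ s := by
  have h1 := (proc_counter hpre N s).1
  have h2 := Nat.unpair_left_le (proc ext N s).1
  have h3 : (proc ext N s).1.unpair.1 = e := h.1.1
  omega

theorem lost_congr {ext : ℕ → ℕ → List Bool → Option (List Bool)}
    (hpre : ∀ s e σ τ, ext s e σ = some τ → σ <+: τ) {N N' : ℕ → ℕ} {e s : ℕ}
    (hN : ∀ d, d ≤ s → N d = N' d) (h : Lost ext N e s) : Lost ext N' e s := by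
  have h1 := lost_le hpre h
  have h2 := proc_congr hpre (N := N) (N' := N') (s := s) fun d hd => hN d hd.le
  unfold Lost Stuck at h ⊢
  rw [← h2, ← hN e h1]
  exact h

/-- Strings of length `n` for which the construction gets lost at `e`. -/
def LostAt (ext : ℕ → ℕ → List Bool → Option (List Bool)) (k n e : ℕ) : Set (Fin n → Bool) :=
  {f | (∃ s, Lost ext (guess k (pad (List.ofFn f))) e s) ∧ ∀ i, i < k + e → Nat.pair e i < n}

theorem pad_ofFn_lt {n : ℕ} (f : Fin n → Bool) {j : ℕ} (hj : j < n) :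
    pad (List.ofFn f) j = f ⟨j, hj⟩ := by
  simp [pad, hj]

theorem pad_ofFn_ge {n : ℕ} (f : Fin n → Bool) {j : ℕ} (hj : n ≤ j) :
    pad (List.ofFn f) j = false := by
  simp [pad, hj]

/-- Replace the block of bits used by requirement `e`. -/
def swapBlock (k n e : ℕ) (x : (Fin n → Bool) × (Fin (k + e) → Bool)) : Fin n → Bool := fun j =>
  if h : j.1.unpair.1 = e ∧ j.1.unpair.2 < k + e then x.2 ⟨j.1.unpair.2, h.2⟩ else x.1 j

theorem lostAt_card {ext : ℕ → ℕ → List Bool → Option (List Bool)}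
    (hmono : ∀ s t e σ τ, s ≤ t → ext s e σ = some τ → ext t e σ = some τ) (k n e : ℕ) :
    Nat.card (LostAt ext k n e) * 2 ^ (k + e) ≤ 2 ^ n := by
  have hinj : Function.Injective fun x : LostAt ext k n e × (Fin (k + e) → Bool) =>
      swapBlock k n e (x.1.1, x.2) := by
    rintro ⟨⟨f, ⟨s, hs⟩, hlt⟩, g⟩ ⟨⟨f', ⟨s', hs'⟩, hlt'⟩, g'⟩ hx
    simp only at hx
    have hoff : ∀ j : Fin n, ¬ (j.1.unpair.1 = e ∧ j.1.unpair.2 < k + e) → f j = f' j := by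
      intro j hj
      have := congrFun hx j
      simpa only [swapBlock, dif_neg hj] using this
    have hg : ∀ d, d ≠ e → guess k (pad (List.ofFn f)) d = guess k (pad (List.ofFn f')) d := by
      intro d hd
      refine guess_congr fun i _ => ?_
      rcases lt_or_ge (Nat.pair d i) n with h | h
      · rw [pad_ofFn_lt f h, pad_ofFn_lt f' h]
        exact hoff _ (by simp [hd])
      · rw [pad_ofFn_ge f h, pad_ofFn_ge f' h]
    have hon := guess_inj (lost_unique hmono hg hs hs')
    have hff : f = f' := by
      funext j
      by_cases hj : j.1.unpair.1 = e ∧ j.1.unpair.2 < k + e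
      · have h1 := hon _ hj.2
        have h2 : Nat.pair e j.1.unpair.2 = j.1 := by
          rw [← hj.1, Nat.pair_unpair]
        rw [h2, pad_ofFn_lt f j.2, pad_ofFn_lt f' j.2] at h1
        exact h1
      · exact hoff j hj
    have hgg : g = g' := by
      funext i
      have := congrFun hx ⟨_, hlt i.1 i.2⟩
      simpa [swapBlock] using this
    subst hff
    subst hgg
    rfl
  have := Nat.card_le_card_of_injective _ hinj
  simpa [Nat.card_prod, Nat.card_eq_fintype_card] using this

theorem bad_cover {ext : ℕ → ℕ → List Bool → Option (List Bool)}
    (hpre : ∀ s e σ τ, ext s e σ = some τ → σ <+: τ) (k n : ℕ) :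
    {f : Fin n → Bool | ∃ σ ∈ badSet ext k, σ <+: List.ofFn f} ⊆
      ⋃ e ∈ Finset.range n, LostAt ext k n e := by
  rintro f ⟨τ, ⟨hk, e, hl⟩, hτ⟩
  obtain ⟨s, hs⟩ := Nat.exists_eq_add_of_le hk
  have hs' : τ.length.sqrt - (k + 1) = s := by omega
  rw [hs'] at hl
  have hlen : (k + s + 1) ^ 2 ≤ τ.length := by
    have := Nat.sqrt_le' τ.length
    rw [hs] at this
    convert this using 2
    omega
  have hn : τ.length ≤ n := by simpa using hτ.length_le
  have he := lost_le hpre hl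
  have hag : ∀ j, j < (k + s + 1) ^ 2 → pad τ j = pad (List.ofFn f) j := by
    intro j hj
    have hj' : j < τ.length := by omega
    obtain ⟨ρ, hρ⟩ := hτ
    rw [← hρ]
    simp [pad, hj', List.getElem?_append_left hj']
  have hsq : s < (k + s + 1) ^ 2 := by nlinarith
  refine Set.mem_biUnion (x := e) (by simp; omega) ⟨⟨s, ?_⟩, fun i hi => ?_⟩
  · exact lost_congr hpre (fun d hd => guess_use hag hd) hl
  · exact (pair_lt_use he hi).trans_le (hlen.trans hn)

theorem badSet_measure {ext : ℕ → ℕ → List Bool → Option (List Bool)}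
    (hmono : ∀ s t e σ τ, s ≤ t → ext s e σ = some τ → ext t e σ = some τ)
    (hpre : ∀ s e σ τ, ext s e σ = some τ → σ <+: τ) (i : ℕ) :
    stringMeasure (badSet ext (i + 2)) < (2 : ℝ≥0∞)⁻¹ ^ i := by
  have hle : stringMeasure (badSet ext (i + 2)) ≤ (2 : ℝ≥0∞)⁻¹ ^ (i + 1) := by
    refine iSup_le fun n => ?_
    have hone : ∀ e, (Nat.card (LostAt ext (i + 2) n e) : ℝ≥0∞) / 2 ^ n
        ≤ (2 : ℝ≥0∞)⁻¹ ^ (i + 2) * 2⁻¹ ^ e := by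
      intro e
      have h1 : (Nat.card (LostAt ext (i + 2) n e) : ℝ≥0∞) * 2 ^ (i + 2 + e) ≤ 2 ^ n := by
        exact_mod_cast lostAt_card hmono (i + 2) n e
      rw [← pow_add, ← ENNReal.inv_pow]
      refine ENNReal.div_le_of_le_mul ?_
      rw [mul_comm, ← div_eq_mul_inv]
      exact (ENNReal.le_div_iff_mul_le (Or.inl (by simp)) (Or.inl (by simp))).2 h1
    have hcard : Nat.card {f : Fin n → Bool // ∃ σ ∈ badSet ext (i + 2), σ <+: List.ofFn f}
        ≤ ∑ e ∈ Finset.range n, Nat.card (LostAt ext (i + 2) n e) := by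
      have h1 := Set.ncard_le_ncard (bad_cover hpre (i + 2) n) (Set.toFinite _)
      have h2 := Finset.set_ncard_biUnion_le (Finset.range n) (LostAt ext (i + 2) n)
      exact h1.trans h2
    calc _ ≤ ((∑ e ∈ Finset.range n, Nat.card (LostAt ext (i + 2) n e) : ℕ) : ℝ≥0∞) / 2 ^ n := by
          gcongr
      _ = ∑ e ∈ Finset.range n, (Nat.card (LostAt ext (i + 2) n e) : ℝ≥0∞) / 2 ^ n := by
          push_cast
          simp only [div_eq_mul_inv, Finset.sum_mul]
      _ ≤ ∑ e ∈ Finset.range n, (2 : ℝ≥0∞)⁻¹ ^ (i + 2) * 2⁻¹ ^ e :=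
          Finset.sum_le_sum fun e _ => hone e
      _ ≤ ∑' e, (2 : ℝ≥0∞)⁻¹ ^ (i + 2) * 2⁻¹ ^ e := ENNReal.sum_le_tsum _
      _ = (2 : ℝ≥0∞)⁻¹ ^ (i + 1) := by
          rw [ENNReal.tsum_mul_left, ENNReal.tsum_geometric, ENNReal.one_sub_inv_two, inv_inv,
            pow_succ, mul_assoc, ENNReal.inv_mul_cancel (by simp) (by simp), mul_one]
  refine hle.trans_lt ?_
  rw [pow_succ]
  have h0 : (2 : ℝ≥0∞)⁻¹ ^ i ≠ 0 := by simp
  have h1 : (2 : ℝ≥0∞)⁻¹ ^ i ≠ ⊤ := by simp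
  calc (2 : ℝ≥0∞)⁻¹ ^ i * 2⁻¹ < (2 : ℝ≥0∞)⁻¹ ^ i * 1 :=
        (ENNReal.mul_lt_mul_iff_right h0 h1).2 (by simp)
    _ = _ := mul_one _

theorem prefix_getElem {l m : List Bool} (h : l <+: m) {n : ℕ} {b : Bool}
    (hb : l[n]? = some b) : m[n]? = some b := by
  obtain ⟨t, rfl⟩ := h
  obtain ⟨hn, _⟩ := List.getElem?_eq_some_iff.1 hb
  rw [List.getElem?_append_left hn, hb]

/-- Kurtz, Kautz: every 2-random Turing degree bounds a 1-generic
Turing degree. -/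
theorem twoRandom_bounds_oneGeneric (A : ℕ → Bool) (hA : TwoRandom A) :
    ∃ G : ℕ → Bool, OneGeneric G ∧ TRed G A := by
  classical
  obtain ⟨ext, hext, hmono, hpre, hW⟩ := exists_ext
  obtain ⟨i, hi⟩ := hA (fun i => badSet ext (i + 2)) ⟨badSet_ce hext, badSet_measure hmono hpre⟩
  generalize hk : i + 2 = k at hi
  have hno : ∀ e s, ¬ Lost ext (guess k A) e s := by
    intro e s hl
    refine hi ⟨(List.range ((k + s + 1) ^ 2)).map A, ⟨?_, e, ?_⟩, ?_⟩
    · simp only [List.length_map, List.length_range, Nat.sqrt_eq']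
      omega
    · simp only [List.length_map, List.length_range, Nat.sqrt_eq']
      rw [show k + s + 1 - (k + 1) = s by omega]
      exact lost_congr hpre
        (fun d hd => guess_use (fun j hj => (pad_isPre A _ j hj).symm) hd) hl
    · intro j
      simp
  have hex : ∀ n : ℕ, ∃ s, n < (proc ext (guess k A) s).2.1.length := by
    intro n
    obtain ⟨t, _, ht⟩ := visits hmono hno n
    have := (proc_counter hpre (guess k A) (t + 1)).2
    exact ⟨t + 1, by omega⟩
  choose T hT using hex
  obtain ⟨G, hGdef⟩ : ∃ G : ℕ → Bool, ∀ n, G n = (proc ext (guess k A) (T n)).2.1[n]'(hT n) :=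
    ⟨_, fun _ => rfl⟩
  have hG : ∀ (n : ℕ) s b, (proc ext (guess k A) s).2.1[n]? = some b → b = G n := by
    intro n s b hb
    have hT' : (proc ext (guess k A) (T n)).2.1[n]? = some (G n) := by
      rw [hGdef, List.getElem?_eq_getElem (hT n)]
    rcases le_total s (T n) with h | h
    · have h1 := prefix_getElem (proc_isPre hpre (guess k A) h) hb
      exact Option.some_injective _ (h1.symm.trans hT')
    · have h1 := prefix_getElem (proc_isPre hpre (guess k A) h) hT'
      exact Option.some_injective _ (hb.symm.trans h1)
  refine ⟨G, ?_, functional hext hpre k A G (fun n => ⟨T n, ?_⟩) hG⟩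
  · intro W hWce
    obtain ⟨e, he⟩ := hW W hWce
    obtain ⟨σ, s, hσ, h⟩ := generic_aux hmono hpre hno (fun σ => (he σ).1) (fun σ => (he σ).2)
    refine ⟨σ, fun j => ?_, h⟩
    refine (hG j.1 s _ ?_).symm
    have h1 : σ[j.1]? = some (σ.get j) := by simp
    exact prefix_getElem hσ h1
  · rw [List.getElem?_eq_getElem (hT n)]
    simp

end TypicalDegree
end

section
/- There is a weakly 2-random Turing degree which does not bound any 1-generic Turing degree. -/
/-
Common framework: oracle (relative) partial computability via codes,
Turing reducibility, the jump, Cantor-space measure, Martin-Löf randomness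
and genericity relative to an oracle, Turing functionals.
-/

open scoped ENNReal

namespace TypicalDegree

/-! ### Computability of oracle codes -/

theorem eval_partrec {α : Type} [Primcodable α] (g : α → ℕ →. ℕ) (hg : Partrec₂ g)
    (c : OracleCode) : Partrec₂ (fun a n => c.eval (g a) n) := by
  induction c with
  | zero => exact (Computable.const 0).partrec
  | succ => exact (Computable.succ.comp Computable.snd).partrec
  | left => exact (Computable.fst.comp (Computable.unpair.comp Computable.snd)).partrec
  | right => exact (Computable.snd.comp (Computable.unpair.comp Computable.snd)).partrec
  | oracle => exact hg
  | pair cf cg hf hg =>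
    have : Partrec (fun p : α × ℕ => (cf.eval (g p.1) p.2).bind fun x =>
        (cg.eval (g p.1) p.2).map fun y => Nat.pair x y) := by
      refine Partrec.bind hf ?_
      refine Partrec.map (hg.comp (Computable.fst.comp Computable.fst)
        (Computable.snd.comp Computable.fst)) ?_
      exact (Primrec₂.natPair.to_comp.comp (Computable.snd.comp Computable.fst) Computable.snd)
    refine this.of_eq ?_
    rintro ⟨a, n⟩
    simp [OracleCode.eval, Seq.seq, Part.map_eq_map, Part.bind_map]
  | comp cf cg hf hg =>
    have : Partrec (fun p : α × ℕ => (cg.eval (g p.1) p.2).bind fun x => cf.eval (g p.1) x) := by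
      refine Partrec.bind hg ?_
      exact hf.comp (Computable.fst.comp Computable.fst) Computable.snd
    exact this
  | prec cf cg hf hg =>
    have : Partrec (fun p : α × ℕ => Nat.rec (motive := fun _ => Part ℕ)
        (cf.eval (g p.1) p.2.unpair.1)
        (fun y IH => IH.bind fun i => cg.eval (g p.1) (Nat.pair p.2.unpair.1 (Nat.pair y i)))
        p.2.unpair.2) := by
      refine Partrec.nat_rec (f := fun p : α × ℕ => p.2.unpair.2)
        (g := fun p : α × ℕ => cf.eval (g p.1) p.2.unpair.1)
        (h := fun (p : α × ℕ) (q : ℕ × ℕ) =>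
          cg.eval (g p.1) (Nat.pair p.2.unpair.1 (Nat.pair q.1 q.2))) ?_ ?_ ?_
      · exact Computable.snd.comp (Computable.unpair.comp Computable.snd)
      · exact hf.comp Computable.fst (Computable.fst.comp (Computable.unpair.comp Computable.snd))
      · refine hg.comp (Computable.fst.comp Computable.fst) ?_
        refine Primrec₂.natPair.to_comp.comp (Computable.fst.comp (Computable.unpair.comp
          (Computable.snd.comp Computable.fst))) ?_
        exact Primrec₂.natPair.to_comp.comp (Computable.fst.comp Computable.snd)
          (Computable.snd.comp Computable.snd)
    exact this
  | rfind' cf hf =>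
    have : Partrec (fun p : α × ℕ => (Nat.rfind fun n => (cf.eval (g p.1)
        (Nat.pair p.2.unpair.1 (n + p.2.unpair.2))).map fun m => decide (m = 0)).map
        (· + p.2.unpair.2)) := by
      refine Partrec.map (Partrec.rfind ?_) ?_
      · refine Partrec.map (f := fun q : (α × ℕ) × ℕ => cf.eval (g q.1.1)
          (Nat.pair q.1.2.unpair.1 (q.2 + q.1.2.unpair.2))) ?_ ?_
        · refine hf.comp (Computable.fst.comp Computable.fst) ?_
          refine Primrec₂.natPair.to_comp.comp (Computable.fst.comp (Computable.unpair.comp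
            (Computable.snd.comp Computable.fst))) ?_
          exact Primrec.nat_add.to_comp.comp Computable.snd (Computable.snd.comp
            (Computable.unpair.comp (Computable.snd.comp Computable.fst)))
        · have : PrimrecPred (fun m : ℕ => m = 0) := Primrec.eq.comp Primrec.id (Primrec.const 0)
          exact (this.decide.to_comp.comp Computable.snd)
      · exact Primrec.nat_add.to_comp.comp Computable.snd (Computable.snd.comp
            (Computable.unpair.comp (Computable.snd.comp Computable.fst)))
    exact this

theorem strOracle_partrec : Partrec₂ strOracle := by
  have : Partrec (fun p : List Bool × ℕ =>
      ((p.1[p.2]?).map (fun b => cond b 1 0) : Option ℕ) : List Bool × ℕ →. ℕ) := by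
    refine Computable.ofOption ?_
    refine Computable.option_map ?_ ?_
    · exact Primrec.list_getElem?.to_comp
    · exact Computable.cond Computable.snd (Computable.const 1) (Computable.const 0)
  refine this.of_eq ?_
  rintro ⟨τ, n⟩
  by_cases h : n < τ.length
  · simp [strOracle, h]
  · simp [strOracle, h]

theorem chi_false_partrec : Nat.Partrec (chi fun _ => false) := by
  have : Computable (fun _ : ℕ => 0) := Computable.const 0
  exact Partrec.nat_iff.1 this.partrec

/-- Embedding of oracle-free codes. -/
def ofCode : Nat.Partrec.Code → OracleCode
  | .zero => .zero
  | .succ => .succ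
  | .left => .left
  | .right => .right
  | .pair a b => .pair (ofCode a) (ofCode b)
  | .comp a b => .comp (ofCode a) (ofCode b)
  | .prec a b => .prec (ofCode a) (ofCode b)
  | .rfind' a => .rfind' (ofCode a)

theorem ofCode_eval (g : ℕ →. ℕ) (c : Nat.Partrec.Code) : (ofCode c).eval g = c.eval := by
  induction c with
  | zero => rfl
  | succ => rfl
  | left => rfl
  | right => rfl
  | pair a b ha hb => simp only [ofCode, OracleCode.eval, Nat.Partrec.Code.eval, ha, hb]; rfl
  | comp a b ha hb => simp only [ofCode, OracleCode.eval, Nat.Partrec.Code.eval, ha, hb]; rfl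
  | prec a b ha hb => simp only [ofCode, OracleCode.eval, Nat.Partrec.Code.eval, ha, hb]; rfl
  | rfind' a ha => simp only [ofCode, OracleCode.eval, Nat.Partrec.Code.eval, ha]; rfl

/-- Use principle. -/
theorem eval_use (g : ℕ →. ℕ) (c : OracleCode) : ∀ n v, v ∈ c.eval g n →
    ∃ m, ∀ g' : ℕ →. ℕ, (∀ i < m, ∀ w ∈ g i, w ∈ g' i) → v ∈ c.eval g' n := by
  induction c with
  | zero => exact fun n v h => ⟨0, fun _ _ => h⟩
  | succ => exact fun n v h => ⟨0, fun _ _ => h⟩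
  | left => exact fun n v h => ⟨0, fun _ _ => h⟩
  | right => exact fun n v h => ⟨0, fun _ _ => h⟩
  | oracle => exact fun n v h => ⟨n + 1, fun g' hg => hg n (Nat.lt_succ_self n) v h⟩
  | pair cf cg hf hg =>
    intro n v h
    simp only [OracleCode.eval, Seq.seq, Part.map_eq_map, Part.bind_eq_bind, Part.mem_bind_iff,
      Part.mem_map_iff] at h ⊢
    obtain ⟨_, ⟨a, ha, rfl⟩, b, hb, rfl⟩ := h
    obtain ⟨m1, h1⟩ := hf _ _ ha
    obtain ⟨m2, h2⟩ := hg _ _ hb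
    refine ⟨max m1 m2, fun g' hg' => ⟨_, ⟨a, h1 g' fun i hi => hg' i (by omega), rfl⟩, b,
      h2 g' fun i hi => hg' i (by omega), rfl⟩⟩
  | comp cf cg hf hg =>
    intro n v h
    obtain ⟨a, ha, hb⟩ := Part.mem_bind_iff.1 h
    obtain ⟨m1, h1⟩ := hg _ _ ha
    obtain ⟨m2, h2⟩ := hf _ _ hb
    exact ⟨max m1 m2, fun g' hg' => Part.mem_bind_iff.2 ⟨a, h1 g' fun i hi => hg' i (by omega),
      h2 g' fun i hi => hg' i (by omega)⟩⟩
  | prec cf cg hf hg =>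
    intro n v h
    simp only [OracleCode.eval, Nat.unpaired, Part.bind_eq_bind] at h ⊢
    generalize n.unpair.1 = a at h ⊢
    generalize n.unpair.2 = k at h ⊢
    induction k generalizing v with
    | zero => exact hf _ _ h
    | succ k ih =>
      simp only [Part.mem_bind_iff] at h ⊢
      obtain ⟨b, hb, hv⟩ := h
      obtain ⟨m1, h1⟩ := ih _ hb
      obtain ⟨m2, h2⟩ := hg _ _ hv
      exact ⟨max m1 m2, fun g' hg' => ⟨b, h1 g' fun i hi => hg' i (by omega),
        h2 g' fun i hi => hg' i (by omega)⟩⟩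
  | rfind' cf hf =>
    intro n v h
    simp only [OracleCode.eval, Nat.unpaired, Part.mem_map_iff, Part.map_eq_map] at h ⊢
    generalize n.unpair.1 = a at h ⊢
    generalize n.unpair.2 = k at h ⊢
    obtain ⟨r, hr, rfl⟩ := h
    obtain ⟨hr0, hlt⟩ := Nat.mem_rfind.1 hr
    obtain ⟨w, hw, hw0⟩ := (Part.mem_map_iff _).1 hr0
    obtain ⟨m0, h0⟩ := hf _ _ hw
    have key : ∀ s, s ≤ r → ∃ m, ∀ g' : ℕ →. ℕ, (∀ i < m, ∀ w ∈ g i, w ∈ g' i) →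
        ∀ j < s, ∃ w ∈ cf.eval g' (Nat.pair a (j + k)), decide (w = 0) = false := by
      intro s
      induction s with
      | zero => exact fun _ => ⟨0, fun _ _ j hj => absurd hj (Nat.not_lt_zero j)⟩
      | succ s ih =>
        intro hs
        obtain ⟨m1, h1⟩ := ih (by omega)
        obtain ⟨w, hw, hw'⟩ := (Part.mem_map_iff _).1 (hlt (show s < r by omega))
        obtain ⟨m2, h2⟩ := hf _ _ hw
        refine ⟨max m1 m2, fun g' hg' j hj => ?_⟩
        rcases Nat.lt_succ_iff_lt_or_eq.1 hj with hj | rfl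
        · exact h1 g' (fun i hi => hg' i (by omega)) j hj
        · exact ⟨w, h2 g' fun i hi => hg' i (by omega), hw'⟩
    obtain ⟨m1, h1⟩ := key r le_rfl
    refine ⟨max m0 m1, fun g' hg' => ⟨r, Nat.mem_rfind.2
      ⟨(Part.mem_map_iff _).2 ⟨w, h0 g' fun i hi => hg' i (by omega), hw0⟩, ?_⟩, rfl⟩⟩
    intro j hj
    exact (Part.mem_map_iff _).2 (h1 g' (fun i hi => hg' i (by omega)) j hj)

/-! ### Sigma-one predicates -/

/-- Predicates of the form `∃ k, R a k` with `R` primitive recursive. -/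
def Sig1 {α : Type} [Primcodable α] (p : α → Prop) : Prop :=
  ∃ R : α → ℕ → Prop, PrimrecRel R ∧ ∀ a, p a ↔ ∃ k, R a k

section Sig1
variable {α β : Type} [Primcodable α] [Primcodable β]

theorem Sig1.of_iff {p q : α → Prop} (hp : Sig1 p) (h : ∀ a, q a ↔ p a) : Sig1 q := by
  obtain ⟨R, hR, hp⟩ := hp
  exact ⟨R, hR, fun a => (h a).trans (hp a)⟩

theorem Sig1.of_prim {p : α → Prop} (hp : PrimrecPred p) : Sig1 p :=
  ⟨fun a _ => p a, hp.comp Primrec.fst, fun a => by simp⟩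

theorem Sig1.comp {p : β → Prop} (hp : Sig1 p) {f : α → β} (hf : Primrec f) :
    Sig1 (fun a => p (f a)) := by
  obtain ⟨R, hR, hp⟩ := hp
  exact ⟨fun a k => R (f a) k, PrimrecRel.comp hR (hf.comp Primrec.fst) Primrec.snd, fun a => hp _⟩

theorem Sig1.or {p q : α → Prop} (hp : Sig1 p) (hq : Sig1 q) : Sig1 (fun a => p a ∨ q a) := by
  obtain ⟨R, hR, hp⟩ := hp
  obtain ⟨S, hS, hq⟩ := hq
  refine ⟨fun a k => R a k ∨ S a k, PrimrecPred.or hR hS, fun a => ?_⟩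
  simp only [hp, hq, exists_or]

theorem Sig1.and {p q : α → Prop} (hp : Sig1 p) (hq : Sig1 q) : Sig1 (fun a => p a ∧ q a) := by
  obtain ⟨R, hR, hp⟩ := hp
  obtain ⟨S, hS, hq⟩ := hq
  refine ⟨fun a k => R a k.unpair.1 ∧ S a k.unpair.2, PrimrecPred.and
    (PrimrecRel.comp hR Primrec.fst (Primrec.fst.comp (Primrec.unpair.comp Primrec.snd)))
    (PrimrecRel.comp hS Primrec.fst (Primrec.snd.comp (Primrec.unpair.comp Primrec.snd))),
    fun a => ?_⟩
  simp only [hp, hq]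
  constructor
  · rintro ⟨⟨k, hk⟩, l, hl⟩
    exact ⟨Nat.pair k l, by simpa using ⟨hk, hl⟩⟩
  · rintro ⟨k, h1, h2⟩
    exact ⟨⟨_, h1⟩, _, h2⟩

/-- a primitive recursive predicate holding of the decoded value -/
theorem prim_decode {R : α × β → ℕ → Prop} (hR : PrimrecRel R) :
    PrimrecRel (fun (a : α) (k : ℕ) =>
      ∃ b l, (Encodable.decode k : Option (β × ℕ)) = some (b, l) ∧ R (a, b) l) := by
  classical
  have h1 : Primrec (fun q : (α × ℕ) × (β × ℕ) => decide (R (q.1.1, q.2.1) q.2.2)) :=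
    PrimrecPred.decide (PrimrecRel.comp hR
      ((Primrec.fst.comp Primrec.fst).pair (Primrec.fst.comp Primrec.snd))
      (Primrec.snd.comp Primrec.snd))
  have h2 : Primrec (fun q : α × ℕ => (Option.casesOn (Encodable.decode q.2 : Option (β × ℕ))
      false (fun bl => decide (R (q.1, bl.1) bl.2)) : Bool)) :=
    Primrec.option_casesOn (Primrec.decode.comp Primrec.snd) (Primrec.const false) h1
  have h3 : PrimrecPred (fun q : α × ℕ => (Option.casesOn (Encodable.decode q.2 : Option (β × ℕ))
      false (fun bl => decide (R (q.1, bl.1) bl.2)) : Bool) = true) :=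
    Primrec.eq.comp h2 (Primrec.const true)
  refine PrimrecPred.of_eq h3 ?_
  rintro ⟨a, k⟩
  simp only
  rcases (Encodable.decode k : Option (β × ℕ)) with _ | ⟨b, l⟩
  · simp
  · simp

theorem Sig1.ex {p : α × β → Prop} (hp : Sig1 p) : Sig1 (fun a => ∃ b, p (a, b)) := by
  obtain ⟨R, hR, hp⟩ := hp
  refine ⟨_, prim_decode hR, fun a => ?_⟩
  constructor
  · rintro ⟨b, hb⟩
    obtain ⟨l, hl⟩ := (hp _).1 hb
    exact ⟨Encodable.encode (b, l), b, l, Encodable.encodek _, hl⟩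
  · rintro ⟨k, b, l, -, hl⟩
    exact ⟨b, (hp _).2 ⟨l, hl⟩⟩

theorem Sig1.ball {p : α × β → Prop} (hp : Sig1 p) {f : α → List β} (hf : Primrec f) :
    Sig1 (fun a => ∀ b ∈ f a, p (a, b)) := by
  obtain ⟨R, hR, hp⟩ := hp
  have h1 : PrimrecRel (fun (j : ℕ) (q : β × α) => R (q.2, q.1) j) :=
    PrimrecRel.comp hR ((Primrec.snd.comp Primrec.snd).pair (Primrec.fst.comp Primrec.snd))
      Primrec.fst
  have h2 : PrimrecRel (fun (k : ℕ) (q : β × α) => ∃ j < k, R (q.2, q.1) j) :=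
    (PrimrecRel.comp h1.exists_mem_list (Primrec.list_range.comp Primrec.fst) Primrec.snd).of_eq
      (by simp)
  have h3 : PrimrecRel (fun (b : β) (q : α × ℕ) => ∃ j < q.2, R (q.1, b) j) :=
    PrimrecRel.comp h2 (Primrec.snd.comp Primrec.snd)
      (Primrec.fst.pair (Primrec.fst.comp Primrec.snd))
  have h4 := h3.forall_mem_list
  have h5 : PrimrecRel (fun (a : α) (k : ℕ) => ∀ b ∈ f a, ∃ j < k, R (a, b) j) :=
    PrimrecRel.comp h4 (hf.comp Primrec.fst) Primrec.id
  refine ⟨_, h5, fun a => ?_⟩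
  constructor
  · intro h
    have : ∀ L : List β, (∀ b ∈ L, p (a, b)) → ∃ k, ∀ b ∈ L, ∃ j < k, R (a, b) j := by
      intro L
      induction L with
      | nil => exact fun _ => ⟨0, by simp⟩
      | cons b L ih =>
        intro hL
        obtain ⟨k, hk⟩ := ih fun b hb => hL b (List.mem_cons_of_mem _ hb)
        obtain ⟨l, hl⟩ := (hp _).1 (hL b List.mem_cons_self)
        refine ⟨k + l + 1, fun c hc => ?_⟩
        rcases List.mem_cons.1 hc with rfl | hc
        · exact ⟨l, by omega, hl⟩
        · obtain ⟨j, hj, hj'⟩ := hk c hc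
          exact ⟨j, by omega, hj'⟩
    exact this _ h
  · rintro ⟨k, hk⟩ b hb
    obtain ⟨j, -, hj⟩ := hk b hb
    exact (hp _).2 ⟨j, hj⟩

/-- Uniformization of Sigma-one relations. -/
theorem Sig1.unif {p : α × β → Prop} (hp : Sig1 p) : ∃ q : α × β → Prop, Sig1 q ∧
    (∀ x, q x → p x) ∧ (∀ a, (∃ b, p (a, b)) → ∃ b, q (a, b)) ∧
    ∀ a b b', q (a, b) → q (a, b') → b = b' := by
  obtain ⟨R, hR, hp⟩ := hp
  have hT := prim_decode hR
  set T := (fun (a : α) (k : ℕ) =>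
      ∃ b l, (Encodable.decode k : Option (β × ℕ)) = some (b, l) ∧ R (a, b) l) with hTdef
  have hT' : PrimrecRel (fun (j : ℕ) (a : α) => ¬ T a j) :=
    PrimrecPred.not (PrimrecRel.comp hT Primrec.snd Primrec.fst)
  have hT2 : PrimrecRel (fun (k : ℕ) (a : α) => ∀ j < k, ¬ T a j) :=
    (PrimrecRel.comp hT'.forall_mem_list (Primrec.list_range.comp Primrec.fst) Primrec.snd).of_eq
      (by simp)
  have hq : Sig1 (fun z : ((α × β) × ℕ) × ℕ =>
      ((Encodable.decode z.1.2 : Option (β × ℕ)) = some (z.1.1.2, z.2) ∧ R z.1.1 z.2) ∧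
      ∀ j < z.1.2, ¬ T z.1.1.1 j) := by
    refine Sig1.of_prim (PrimrecPred.and (PrimrecPred.and ?_ ?_) ?_)
    · exact Primrec.eq.comp (Primrec.decode.comp (Primrec.snd.comp Primrec.fst))
        (Primrec.option_some.comp ((Primrec.snd.comp (Primrec.fst.comp Primrec.fst)).pair
          Primrec.snd))
    · exact PrimrecRel.comp hR (Primrec.fst.comp Primrec.fst) Primrec.snd
    · exact PrimrecRel.comp hT2 (Primrec.snd.comp Primrec.fst)
        (Primrec.fst.comp (Primrec.fst.comp Primrec.fst))
  refine ⟨_, hq.ex.ex, ?_, ?_, ?_⟩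
  · rintro x ⟨m, l, ⟨-, h⟩, -⟩
    exact (hp x).2 ⟨l, h⟩
  · rintro a ⟨b, hb⟩
    classical
    obtain ⟨l, hl⟩ := (hp _).1 hb
    have hex : ∃ m, T a m := ⟨Encodable.encode (b, l), b, l, Encodable.encodek _, hl⟩
    obtain ⟨b', l', h1, h2⟩ := Nat.find_spec hex
    exact ⟨b', Nat.find hex, l', ⟨h1, h2⟩, fun j hj => Nat.find_min hex hj⟩
  · rintro a b b' ⟨m, l, ⟨h1, h2⟩, h3⟩ ⟨m', l', ⟨h1', h2'⟩, h3'⟩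
    have e : m = m' := by
      rcases lt_trichotomy m m' with h | h | h
      · exact absurd ⟨b, l, h1, h2⟩ (h3' m h)
      · exact h
      · exact absurd ⟨b', l', h1', h2'⟩ (h3 m' h)
    subst e
    simp only at h1 h1'
    rw [h1] at h1'
    simpa using (congrArg Prod.fst (Option.some.inj h1'))

theorem Sig1.of_partrec {f : α →. ℕ} (hf : Partrec f) :
    Sig1 (fun z : α × ℕ => z.2 ∈ f z.1) := by
  obtain ⟨c, hc⟩ := Nat.Partrec.Code.exists_code.1 hf
  refine ⟨fun z k => Nat.Partrec.Code.evaln k c (Encodable.encode z.1) = some z.2, ?_, ?_⟩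
  · refine Primrec.eq.comp (Nat.Partrec.Code.primrec_evaln.comp
      ((Primrec.snd.pair (Primrec.const c)).pair
        (Primrec.encode.comp (Primrec.fst.comp Primrec.fst)))) ?_
    exact Primrec.option_some.comp (Primrec.snd.comp Primrec.fst)
  · rintro ⟨a, v⟩
    have h1 : v ∈ f a ↔ v ∈ c.eval (Encodable.encode a) := by
      rw [hc]; simp
    simp only
    rw [h1, Nat.Partrec.Code.evaln_complete]
    rfl

theorem Sig1.dom {f : α →. ℕ} (hf : Partrec f) : Sig1 (fun a : α => (f a).Dom) :=
  (Sig1.of_partrec hf).ex.of_iff fun _ => Part.dom_iff_mem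

end Sig1

theorem Sig1.ce {W : Set (List Bool)} (hW : Sig1 (fun σ => σ ∈ W)) : CE W := by
  classical
  obtain ⟨R, hR, hW⟩ := hW
  have h1 : Partrec (fun σ : List Bool => Nat.rfind fun k => Part.some (decide (R σ k))) :=
    Partrec.rfind (PrimrecPred.decide hR).to_comp.partrec
  obtain ⟨c, hc⟩ := Nat.Partrec.Code.exists_code.1 h1
  refine ⟨ofCode c, fun σ => ?_⟩
  rw [ofCode_eval, hc]
  refine (hW σ).trans ?_
  simp only [Encodable.encodek, Part.coe_some, Part.bind_some]
  refine Iff.trans ?_ (Nat.rfind_dom (p := fun k => Part.some (decide (R σ k)))).symm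
  constructor
  · rintro ⟨k, hk⟩
    exact ⟨k, by simpa using hk, fun _ => trivial⟩
  · rintro ⟨k, hk, -⟩
    exact ⟨k, by simpa using hk⟩

theorem Sig1.of_uniform {d : OracleCode} {V : ℕ → Set (List Bool)}
    (h : ∀ (i : ℕ) (σ : List Bool),
    σ ∈ V i ↔ (d.eval (chi fun _ => false) (Nat.pair i (Encodable.encode σ))).Dom) :
    Sig1 (fun z : List Bool × ℕ => z.1 ∈ V z.2) := by
  have h1 : Partrec₂ (fun (_ : Unit) n => d.eval (chi fun _ => false) n) :=
    eval_partrec (fun _ => chi fun _ => false)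
      ((Partrec.nat_iff.2 chi_false_partrec).comp Computable.snd) d
  have h2 : Partrec (fun z : List Bool × ℕ =>
      d.eval (chi fun _ => false) (Nat.pair z.2 (Encodable.encode z.1))) :=
    h1.comp (Computable.const ()) (Primrec₂.natPair.to_comp.comp Computable.snd
      (Computable.encode.comp Computable.fst))
  exact (Sig1.dom h2).of_iff fun z => h z.2 z.1

theorem Sig1.eval (c : OracleCode) :
    Sig1 (fun z : (List Bool × ℕ) × ℕ => z.2 ∈ c.eval (strOracle z.1.1) z.1.2) :=
  Sig1.of_partrec (eval_partrec _ strOracle_partrec c)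

/-! ### Measure -/

open MeasureTheory

/-- the fair coin measure -/
noncomputable def coin : Measure Bool := (PMF.uniformOfFintype Bool).toMeasure

instance : IsProbabilityMeasure coin := by unfold coin; infer_instance

/-- the fair coin measure on Cantor space -/
noncomputable def mu : Measure (ℕ → Bool) := Measure.infinitePi (fun _ => coin)

instance : IsProbabilityMeasure mu := by unfold mu; infer_instance

theorem coin_singleton (b : Bool) : coin {b} = 2⁻¹ := by
  unfold coin
  rw [PMF.toMeasure_apply_singleton _ _ (measurableSet_singleton b)]
  simp

/-- restriction of a sequence to its first `n` entries -/
def res (n : ℕ) (X : ℕ → Bool) : Fin n → Bool := fun i => X i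

theorem res_continuous (n : ℕ) : Continuous (res n) := by
  unfold res; fun_prop

theorem res_measurable (n : ℕ) : Measurable (res n) := by
  unfold res; fun_prop

theorem mu_res_singleton (n : ℕ) (f : Fin n → Bool) : mu (res n ⁻¹' {f}) = 2⁻¹ ^ n := by
  have h : res n ⁻¹' {f} = Set.pi (Finset.range n : Set ℕ)
      (fun i => if h : i < n then {f ⟨i, h⟩} else Set.univ) := by
    ext X
    simp only [Set.mem_preimage, Set.mem_singleton_iff, Set.mem_pi, Finset.coe_range, Set.mem_Iio]
    constructor
    · rintro rfl i hi
      simp [hi, res]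
    · intro h
      ext i
      have := h i i.2
      simpa [res] using this
  rw [h, mu, Measure.infinitePi_pi _ (fun i _ => by split_ifs <;> measurability)]
  rw [Finset.prod_congr rfl (g := fun _ => (2⁻¹ : ℝ≥0∞))]
  · simp
  · intro i hi
    rw [dif_pos (Finset.mem_range.1 hi), coin_singleton]

theorem mu_res (n : ℕ) (S : Set (Fin n → Bool)) :
    mu (res n ⁻¹' S) = (Nat.card S : ℝ≥0∞) / 2 ^ n := by
  classical
  have h : res n ⁻¹' S = ⋃ f ∈ S.toFinset, res n ⁻¹' {f} := by
    ext X; simp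
  rw [h, measure_biUnion_finset]
  · simp only [mu_res_singleton, Finset.sum_const, nsmul_eq_mul, Nat.card_eq_fintype_card,
      Set.toFinset_card, div_eq_mul_inv, ENNReal.inv_pow]
  · intro f _ g _ hfg
    exact Disjoint.preimage _ (by simpa using hfg)
  · exact fun f _ => res_measurable n (measurableSet_singleton f)

/-- the first `n` bits, as a string -/
def pre (X : ℕ → Bool) (n : ℕ) : List Bool := List.ofFn (res n X)

@[simp] theorem pre_length (X : ℕ → Bool) (n : ℕ) : (pre X n).length = n := by simp [pre]

theorem pre_getElem (X : ℕ → Bool) (n i : ℕ) (h : i < (pre X n).length) :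
    (pre X n)[i] = X i := by simp [pre, res]

theorem extendsStr_iff (X : ℕ → Bool) (σ : List Bool) : extendsStr X σ ↔ pre X σ.length = σ := by
  constructor
  · intro h
    refine List.ext_getElem (by simp) fun i h1 h2 => ?_
    rw [pre_getElem]
    exact h ⟨i, h2⟩
  · intro h i
    have h2 : i.1 < (pre X σ.length).length := by simp
    have := pre_getElem X σ.length i h2
    rw [← this]
    simp [h]

theorem pre_mono (X : ℕ → Bool) {m n : ℕ} (h : m ≤ n) : pre X m <+: pre X n := by
  rw [List.prefix_iff_eq_take]
  refine List.ext_getElem (by simp [h]) fun i h1 h2 => ?_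
  rw [List.getElem_take, pre_getElem, pre_getElem]

theorem extends_of_pre (X : ℕ → Bool) {n : ℕ} {σ : List Bool} (h : σ <+: pre X n) :
    extendsStr X σ := by
  rw [extendsStr_iff]
  have hl : σ.length ≤ n := by simpa using h.length_le
  rw [List.prefix_iff_eq_take] at h
  have h2 := pre_mono X hl
  rw [List.prefix_iff_eq_take] at h2
  rw [h2, pre_length, ← h]

/-- upward closed sets of strings -/
def Up (V : Set (List Bool)) : Prop := ∀ σ τ, σ <+: τ → σ ∈ V → τ ∈ V

theorem openOf_eq (V : Set (List Bool)) :
    openOf V = ⋃ n, res n ⁻¹' {f | ∃ σ ∈ V, σ <+: List.ofFn f} := by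
  ext X
  simp only [openOf, Set.mem_ofPred_eq, Set.mem_iUnion, Set.mem_preimage]
  constructor
  · rintro ⟨σ, hσ, h⟩
    refine ⟨σ.length, σ, hσ, ?_⟩
    rw [extendsStr_iff] at h
    change σ <+: pre X σ.length
    rw [h]
  · rintro ⟨n, σ, hσ, h⟩
    exact ⟨σ, hσ, extends_of_pre X h⟩

theorem isOpen_openOf (V : Set (List Bool)) : IsOpen (openOf V) := by
  rw [openOf_eq]
  exact isOpen_iUnion fun n => (isOpen_discrete _).preimage (res_continuous n)

theorem mem_openOf_up {V : Set (List Bool)} (hV : Up V) (X : ℕ → Bool) :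
    X ∈ openOf V ↔ ∃ n, pre X n ∈ V := by
  constructor
  · rintro ⟨σ, hσ, h⟩
    exact ⟨σ.length, by rwa [(extendsStr_iff X σ).1 h]⟩
  · rintro ⟨n, h⟩
    exact ⟨_, h, extends_of_pre X List.prefix_rfl⟩

theorem openOf_mono {V W : Set (List Bool)} (h : V ⊆ W) : openOf V ⊆ openOf W :=
  fun _ ⟨σ, hσ, hX⟩ => ⟨σ, h hσ, hX⟩

theorem mu_openOf_le (V : Set (List Bool)) : mu (openOf V) ≤ stringMeasure V := by
  rw [openOf_eq, Monotone.measure_iUnion]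
  · refine iSup_mono fun n => ?_
    rw [mu_res]
    exact le_rfl
  · intro m n hmn X
    simp only [Set.mem_preimage, Set.mem_ofPred_eq]
    rintro ⟨σ, hσ, h⟩
    exact ⟨σ, hσ, h.trans (pre_mono X hmn)⟩

theorem mu_le_cantorMeasure (S : Set (ℕ → Bool)) : mu S ≤ cantorMeasure S :=
  le_iInf fun V => le_iInf fun h => (measure_mono h).trans (mu_openOf_le V)

/-! ### Enumerating strings and the smallness condition -/

/-- all strings of length `n` -/
def allStr : ℕ → List (List Bool)
  | 0 => [[]]
  | n + 1 => (allStr n).map (List.cons true) ++ (allStr n).map (List.cons false)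

theorem mem_allStr (n : ℕ) (σ : List Bool) : σ ∈ allStr n ↔ σ.length = n := by
  induction n generalizing σ with
  | zero => simp [allStr]
  | succ n ih =>
    cases σ with
    | nil => simp [allStr]
    | cons b σ => cases b <;> simp [allStr, ih]

theorem allStr_primrec : Primrec allStr := by
  have : Primrec (fun n : ℕ => (Nat.rec [[]] (fun _ L =>
      L.map (List.cons true) ++ L.map (List.cons false)) n : List (List Bool))) := by
    refine Primrec.nat_rec₁ _ ?_
    refine Primrec.list_append.comp ?_ ?_
    · exact Primrec.list_map Primrec.snd (Primrec.list_cons.comp (Primrec.const true) Primrec.snd)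
    · exact Primrec.list_map Primrec.snd (Primrec.list_cons.comp (Primrec.const false) Primrec.snd)
  refine this.of_eq fun n => ?_
  induction n with
  | zero => rfl
  | succ n ih => simp only [allStr, ← ih]

/-- the complement of `openOf B` has a finite witness that it has measure at most `2^-e` -/
def Small (B : Set (List Bool)) (e : ℕ) : Prop :=
  ∃ (n : ℕ) (L : List (List Bool)), L.length * 2 ^ e ≤ 2 ^ n ∧ ∀ ρ ∈ allStr n, ρ ∈ L ∨ ρ ∈ B

theorem Small.measure {B : Set (List Bool)} (e : ℕ) (h : Small B e) :
    mu (openOf B)ᶜ ≤ 2⁻¹ ^ e := by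
  classical
  obtain ⟨n, L, hL, h⟩ := h
  have h1 : (openOf B)ᶜ ⊆ res n ⁻¹' {f | List.ofFn f ∈ L} := by
    intro X hX
    rcases h (pre X n) ((mem_allStr _ _).2 (pre_length X n)) with h | h
    · exact h
    · exact absurd ⟨_, h, extends_of_pre X List.prefix_rfl⟩ hX
  refine (measure_mono h1).trans ?_
  rw [mu_res]
  have h2 : Nat.card {f : Fin n → Bool | List.ofFn f ∈ L} ≤ L.length := by
    have : Nat.card {f : Fin n → Bool | List.ofFn f ∈ L} ≤ Nat.card L.toFinset := by
      refine Nat.card_le_card_of_injective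
        (fun f => (⟨List.ofFn f.1, List.mem_toFinset.2 f.2⟩ : L.toFinset)) ?_
      intro f g hfg
      exact Subtype.ext (List.ofFn_injective (congrArg Subtype.val hfg))
    refine this.trans ?_
    rw [Nat.card_eq_fintype_card, Fintype.card_coe]
    exact L.toFinset_card_le
  have h3 : (Nat.card {f : Fin n → Bool | List.ofFn f ∈ L} : ℝ≥0∞) * 2 ^ e ≤ 2 ^ n := by
    have := (Nat.mul_le_mul_right (2 ^ e) h2).trans hL
    exact_mod_cast this
  rw [← ENNReal.inv_pow]
  refine ENNReal.div_le_of_le_mul ?_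
  rw [← ENNReal.div_eq_inv_mul]
  refine (ENNReal.le_div_iff_mul_le (by simp) (by simp)).2 h3

theorem Small.of_measure {B : Set (List Bool)} (hB : Up B) (e : ℕ)
    (h : mu (openOf B)ᶜ < 2⁻¹ ^ e) : Small B e := by
  classical
  set C : ℕ → Set (ℕ → Bool) := fun n => res n ⁻¹' {f | List.ofFn f ∉ B} with hC
  have hCm : Antitone C := by
    intro m n hmn X hX hX'
    exact hX (hB _ _ (pre_mono X hmn) hX')
  have hI : (openOf B)ᶜ = ⋂ n, C n := by
    ext X
    rw [Set.mem_compl_iff, mem_openOf_up hB]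
    simp [hC, pre]
  have ht : Filter.Tendsto (fun n => mu (C n)) Filter.atTop (nhds (mu (⋂ n, C n))) :=
    tendsto_measure_iInter_atTop (fun n => (res_measurable n
      (Set.toFinite _).measurableSet).nullMeasurableSet) hCm ⟨0, measure_ne_top _ _⟩
  rw [hI] at h
  obtain ⟨n, hn⟩ := (ht.eventually_lt_const h).exists
  refine ⟨n, (Finset.univ.filter (fun f : Fin n → Bool => List.ofFn f ∉ B)).toList.map List.ofFn,
    ?_, ?_⟩
  · rw [hC] at hn
    simp only [mu_res] at hn
    have hcard : Nat.card {f : Fin n → Bool | List.ofFn f ∉ B} =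
        (Finset.univ.filter (fun f : Fin n → Bool => List.ofFn f ∉ B)).card := by
      rw [Nat.card_eq_fintype_card, ← Set.toFinset_card]
      congr 1; ext; simp
    rw [hcard] at hn
    rw [List.length_map, Finset.length_toList]
    have h3 := hn.le
    rw [← ENNReal.inv_pow, ENNReal.div_le_iff (by simp) (by simp), ← ENNReal.div_eq_inv_mul,
      ENNReal.le_div_iff_mul_le (by simp) (by simp)] at h3
    exact_mod_cast h3
  · intro ρ hρ
    rw [mem_allStr] at hρ
    by_cases hb : ρ ∈ B
    · exact Or.inr hb
    · left
      subst hρ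
      rw [List.mem_map]
      exact ⟨ρ.get, by simpa using hb, List.ofFn_get ρ⟩

theorem two_pow_primrec : Primrec (fun n : ℕ => 2 ^ n) := by
  have : Primrec (fun n : ℕ => (Nat.rec 1 (fun _ y => 2 * y) n : ℕ)) :=
    Primrec.nat_rec₁ _ (Primrec.nat_mul.comp (Primrec.const 2) Primrec.snd)
  refine this.of_eq fun n => ?_
  induction n with
  | zero => rfl
  | succ n ih => simp only [ih]; ring

theorem small_sig1 {α : Type} [Primcodable α] {B : α → Set (List Bool)}
    (hB : Sig1 (fun z : α × List Bool => z.2 ∈ B z.1)) {e : α → ℕ} (he : Primrec e) :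
    Sig1 (fun a => Small (B a) (e a)) := by
  have h1 : Sig1 (fun z : ((α × ℕ) × List (List Bool)) × List Bool =>
      z.2 ∈ z.1.2 ∨ z.2 ∈ B z.1.1.1) := by
    refine Sig1.or (Sig1.of_prim ?_) ?_
    · have hr : PrimrecRel (fun (L : List (List Bool)) (b : List Bool) => ∃ a ∈ L, a = b) :=
        PrimrecRel.exists_mem_list Primrec.eq
      refine (PrimrecRel.comp hr (Primrec.snd.comp Primrec.fst) Primrec.snd).of_eq ?_
      intro z; simp
    · exact hB.comp ((Primrec.fst.comp (Primrec.fst.comp Primrec.fst)).pair Primrec.snd)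
  have h2 := h1.ball (f := fun y : (α × ℕ) × List (List Bool) => allStr y.1.2)
    (allStr_primrec.comp (Primrec.snd.comp Primrec.fst))
  have h3 : Sig1 (fun y : (α × ℕ) × List (List Bool) =>
      y.2.length * 2 ^ (e y.1.1) ≤ 2 ^ y.1.2) := by
    refine Sig1.of_prim (Primrec.nat_le.comp ?_ ?_)
    · exact Primrec.nat_mul.comp (Primrec.list_length.comp Primrec.snd)
        (two_pow_primrec.comp (he.comp (Primrec.fst.comp Primrec.fst)))
    · exact two_pow_primrec.comp (Primrec.snd.comp Primrec.fst)
  exact (h3.and h2).ex.ex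

/-! ### Forcing -/

open MeasureTheory

theorem eval_str_mono (c : OracleCode) {σ τ : List Bool} (h : σ <+: τ) {n v : ℕ}
    (hv : v ∈ c.eval (strOracle σ) n) : v ∈ c.eval (strOracle τ) n := by
  obtain ⟨m, hm⟩ := eval_use _ c n v hv
  refine hm _ fun i _ w hw => ?_
  unfold strOracle at hw ⊢
  by_cases hi : i < σ.length
  · have hi' : i < τ.length := hi.trans_le h.length_le
    rw [dif_pos hi] at hw
    rw [dif_pos hi']
    have : τ[i] = σ[i] := (h.getElem hi).symm
    simpa [this] using hw
  · rw [dif_neg hi] at hw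
    exact absurd hw (Part.notMem_none _)

theorem eval_chi_iff (c : OracleCode) (X : ℕ → Bool) (n v : ℕ) :
    v ∈ c.eval (chi X) n ↔ ∃ m, v ∈ c.eval (strOracle (pre X m)) n := by
  constructor
  · intro h
    obtain ⟨m, hm⟩ := eval_use _ c n v h
    refine ⟨m, hm _ fun i hi w hw => ?_⟩
    have hi' : i < (pre X m).length := by simpa using hi
    unfold strOracle
    rw [dif_pos hi']
    have := pre_getElem X m i hi'
    simpa [this, chi] using hw
  · rintro ⟨m, h⟩
    obtain ⟨k, hk⟩ := eval_use _ c n v h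
    refine hk _ fun i _ w hw => ?_
    unfold strOracle at hw
    by_cases hi : i < (pre X m).length
    · rw [dif_pos hi] at hw
      have := pre_getElem X m i hi
      simpa [this, chi] using hw
    · rw [dif_neg hi] at hw
      exact absurd hw (Part.notMem_none _)

/-- forcing conditions: complements of c.e. open sets, of positive measure -/
structure Cond (V : Set (List Bool)) : Prop where
  up : Up V
  sig : Sig1 (fun σ => σ ∈ V)
  pos : mu (openOf V)ᶜ ≠ 0

theorem Up.union {V W : Set (List Bool)} (hV : Up V) (hW : Up W) : Up (V ∪ W) :=
  fun σ τ h hσ => hσ.imp (hV σ τ h) (hW σ τ h)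

theorem openOf_union (V W : Set (List Bool)) : openOf (V ∪ W) = openOf V ∪ openOf W := by
  ext X
  constructor
  · rintro ⟨σ, h | h, hX⟩
    exacts [Or.inl ⟨σ, h, hX⟩, Or.inr ⟨σ, h, hX⟩]
  · rintro (⟨σ, h, hX⟩ | ⟨σ, h, hX⟩)
    exacts [⟨σ, Or.inl h, hX⟩, ⟨σ, Or.inr h, hX⟩]

theorem step_random {V : Set (List Bool)} (hV : Cond V) {U : ℕ → Set (List Bool)}
    (hU : UniformCEIn (fun _ => false) U) (h0 : mu (⋂ i, openOf (U i)) = 0) :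
    ∃ V', V ⊆ V' ∧ Cond V' ∧ ∀ A, A ∉ openOf V' → A ∉ ⋂ i, openOf (U i) := by
  obtain ⟨d, hd⟩ := hU
  have hs := Sig1.of_uniform hd
  set W : ℕ → Set (List Bool) := fun i => {ρ | ∃ σ t, σ ∈ U i ∧ σ ++ t = ρ} with hW
  have hWs : Sig1 (fun z : List Bool × ℕ => z.1 ∈ W z.2) := by
    have h1 : Sig1 (fun z : ((List Bool × ℕ) × List Bool) × List Bool =>
        z.1.2 ∈ U z.1.1.2 ∧ z.1.2 ++ z.2 = z.1.1.1) := by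
      refine Sig1.and ?_ (Sig1.of_prim ?_)
      · exact hs.comp (f := fun z : ((List Bool × ℕ) × List Bool) × List Bool =>
          (z.1.2, z.1.1.2)) ((Primrec.snd.comp Primrec.fst).pair
          (Primrec.snd.comp (Primrec.fst.comp Primrec.fst)))
      · exact Primrec.eq.comp (Primrec.list_append.comp (Primrec.snd.comp Primrec.fst) Primrec.snd)
          (Primrec.fst.comp (Primrec.fst.comp Primrec.fst))
    exact h1.ex.ex
  have hWup : ∀ i, Up (W i) := by
    rintro i σ τ ⟨u, rfl⟩ ⟨ρ, t, hρ, rfl⟩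
    exact ⟨ρ, t ++ u, hρ, by simp⟩
  set S : ℕ → Set (ℕ → Bool) := fun k => ⋂ i ∈ Finset.range k, openOf (U i) with hS
  have hSa : Antitone S := by
    intro m n hmn
    exact Set.biInter_subset_biInter_left (by simpa using hmn)
  have hSI : ⋂ k, S k = ⋂ i, openOf (U i) := by
    ext X
    simp only [hS, Set.mem_iInter, Finset.mem_range]
    exact ⟨fun h i => h (i + 1) i (Nat.lt_succ_self i), fun h _ i _ => h i⟩
  have ht : Filter.Tendsto (fun n => mu (S n)) Filter.atTop (nhds (mu (⋂ n, S n))) :=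
    tendsto_measure_iInter_atTop (fun n => (Finset.measurableSet_biInter _ fun i _ =>
      (isOpen_openOf _).measurableSet).nullMeasurableSet) hSa ⟨0, measure_ne_top _ _⟩
  rw [hSI, h0] at ht
  obtain ⟨k, hk⟩ := (ht.eventually_lt_const (pos_iff_ne_zero.2 hV.pos)).exists
  set V1 : Set (List Bool) := {ρ | ∀ i ∈ List.range k, ρ ∈ W i} with hV1
  refine ⟨V ∪ V1, Set.subset_union_left, ⟨?_, ?_, ?_⟩, ?_⟩
  · exact hV.up.union fun σ τ h hσ i hi => hWup i σ τ h (hσ i hi)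
  · exact hV.sig.or (hWs.ball (f := fun _ => List.range k) (Primrec.const _))
  · intro h
    have h1 : (openOf V)ᶜ ⊆ (openOf (V ∪ V1))ᶜ ∪ S k := by
      intro X hX
      by_cases hX1 : X ∈ openOf (V ∪ V1)
      · right
        rw [openOf_union] at hX1
        obtain ⟨ρ, hρ, hXρ⟩ := hX1.resolve_left hX
        simp only [hS, Set.mem_iInter, Finset.mem_range]
        intro i hi
        obtain ⟨σ, t, hσ, rfl⟩ := hρ i (List.mem_range.2 hi)
        refine ⟨σ, hσ, extends_of_pre X (n := (σ ++ t).length) ?_⟩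
        rw [(extendsStr_iff _ _).1 hXρ]
        exact ⟨t, rfl⟩
      · exact Or.inl hX1
    have h2 := (measure_mono h1).trans (measure_union_le (μ := mu) _ _)
    rw [h, zero_add] at h2
    exact absurd hk (not_lt.2 h2)
  · intro A hA hA'
    rw [Set.mem_iInter] at hA'
    choose σ hσ hσA using hA'
    apply hA
    refine ⟨pre A ((Finset.range k).sup fun i => (σ i).length), Or.inr fun i hi => ?_,
      extends_of_pre A List.prefix_rfl⟩
    have hle : (σ i).length ≤ (Finset.range k).sup fun i => (σ i).length :=
      Finset.le_sup (f := fun i => (σ i).length) (Finset.mem_range.2 (List.mem_range.1 hi))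
    obtain ⟨t, ht⟩ := pre_mono A hle
    rw [(extendsStr_iff _ _).1 (hσA i)] at ht
    exact ⟨σ i, t, hσ i, ht⟩

/-- strings forcing the functional to disagree with `τ`, together with `V` -/
def Bad (c : OracleCode) (V : Set (List Bool)) (τ : List Bool) : Set (List Bool) :=
  V ∪ {ρ | ∃ (i : ℕ) (b : Bool) (v : ℕ), τ[i]? = some b ∧ v ∈ c.eval (strOracle ρ) i ∧
    v ≠ cond b 1 0}

theorem Bad.up (c : OracleCode) {V : Set (List Bool)} (hV : Up V) (τ : List Bool) :
    Up (Bad c V τ) := by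
  refine hV.union ?_
  rintro σ ρ h ⟨i, b, v, h1, h2, h3⟩
  exact ⟨i, b, v, h1, eval_str_mono c h h2, h3⟩

theorem cond_primrec : Primrec (fun b : Bool => (cond b 1 0 : ℕ)) :=
  Primrec.cond Primrec.id (Primrec.const 1) (Primrec.const 0)

theorem Bad.sig (c : OracleCode) {V : Set (List Bool)} (hV : Sig1 (fun σ => σ ∈ V)) :
    Sig1 (fun z : List Bool × List Bool => z.2 ∈ Bad c V z.1) := by
  refine Sig1.or (hV.comp Primrec.snd) ?_
  have h1 : Sig1 (fun z : (((List Bool × List Bool) × ℕ) × Bool) × ℕ =>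
      z.1.1.1.1[z.1.1.2]? = some z.1.2 ∧ z.2 ∈ c.eval (strOracle z.1.1.1.2) z.1.1.2 ∧
      z.2 ≠ cond z.1.2 1 0) := by
    refine Sig1.and (Sig1.of_prim ?_) (Sig1.and ?_ (Sig1.of_prim ?_))
    · exact Primrec.eq.comp (Primrec.list_getElem?.comp
        (Primrec.fst.comp (Primrec.fst.comp (Primrec.fst.comp Primrec.fst)))
        (Primrec.snd.comp (Primrec.fst.comp Primrec.fst)))
        (Primrec.option_some.comp (Primrec.snd.comp Primrec.fst))
    · exact (Sig1.eval c).comp (f := fun z : (((List Bool × List Bool) × ℕ) × Bool) × ℕ =>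
        ((z.1.1.1.2, z.1.1.2), z.2))
        (((Primrec.snd.comp (Primrec.fst.comp (Primrec.fst.comp Primrec.fst))).pair
          (Primrec.snd.comp (Primrec.fst.comp Primrec.fst))).pair Primrec.snd)
    · exact PrimrecPred.not (Primrec.eq.comp Primrec.snd
        (cond_primrec.comp (Primrec.snd.comp Primrec.fst)))
  exact h1.ex.ex.ex

theorem bad_compl {c : OracleCode} {V : Set (List Bool)} {τ : List Bool} {X : ℕ → Bool}
    (hX : X ∉ openOf (Bad c V τ)) {i v : ℕ} {b : Bool} (hb : τ[i]? = some b)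
    (hv : v ∈ c.eval (chi X) i) : v = cond b 1 0 := by
  by_contra hne
  obtain ⟨m, hm⟩ := (eval_chi_iff c X i v).1 hv
  exact hX ⟨pre X m, Or.inr ⟨i, b, v, hb, hm, hne⟩, extends_of_pre X List.prefix_rfl⟩

/-- Below a condition forcing totality, small preimages are dense. -/
theorem bad_dense (c : OracleCode) {V : Set (List Bool)}
    (hT : ∀ n, mu ((openOf V)ᶜ ∩ {X | ¬ (c.eval (chi X) n).Dom}) = 0) (σ : List Bool) (e : ℕ) :
    ∃ τ, σ <+: τ ∧ mu (openOf (Bad c V τ))ᶜ < 2⁻¹ ^ e := by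
  set t : ℕ → List Bool := fun j => σ ++ (List.replicate j false ++ [true]) with ht
  have htj : ∀ j, (t j)[σ.length + j]? = some true := by
    intro j
    simp [ht, List.getElem?_append]
  have htk : ∀ j k, j < k → (t k)[σ.length + j]? = some false := by
    intro j k hjk
    simp [ht, List.getElem?_append, hjk]
  have hdis : ∀ j k, j < k → AEDisjoint mu (openOf (Bad c V (t j)))ᶜ (openOf (Bad c V (t k)))ᶜ := by
    intro j k hjk
    refine measure_mono_null ?_ (hT (σ.length + j))
    rintro X ⟨h1, h2⟩
    refine ⟨fun h => h1 (openOf_mono Set.subset_union_left h), fun hd => ?_⟩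
    obtain ⟨v, hv⟩ := Part.dom_iff_mem.1 hd
    have e1 := bad_compl h1 (htj j) hv
    have e2 := bad_compl h2 (htk j k hjk) hv
    simp [e1] at e2
  have hsum : ∑' j, mu (openOf (Bad c V (t j)))ᶜ ≠ ⊤ := by
    rw [← measure_iUnion₀]
    · exact measure_ne_top _ _
    · intro j k hjk
      rcases lt_or_gt_of_ne hjk with h | h
      · exact hdis j k h
      · exact (hdis k j h).symm
    · exact fun j => (isOpen_openOf _).measurableSet.compl.nullMeasurableSet
  have hlim := ENNReal.tendsto_atTop_zero_of_tsum_ne_top hsum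
  have hpos : (0 : ℝ≥0∞) < 2⁻¹ ^ e := ENNReal.pow_pos (by simp) e
  obtain ⟨j, hj⟩ := (hlim.eventually_lt_const hpos).exists
  exact ⟨t j, ⟨_, rfl⟩, hj⟩

theorem tsum_strings_le (e : ℕ) :
    ∑' σ : List Bool, (2⁻¹ : ℝ≥0∞) ^ (e + 1 + Encodable.encode σ) ≤ 2⁻¹ ^ e := by
  have h1 : ∑' σ : List Bool, (2⁻¹ : ℝ≥0∞) ^ (e + 1 + Encodable.encode σ) ≤
      ∑' n : ℕ, (2⁻¹ : ℝ≥0∞) ^ (e + 1 + n) :=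
    ENNReal.tsum_comp_le_tsum_of_injective (f := fun σ : List Bool => Encodable.encode σ)
      Encodable.encode_injective (fun n => (2⁻¹ : ℝ≥0∞) ^ (e + 1 + n))
  refine h1.trans ?_
  simp_rw [pow_add]
  rw [ENNReal.tsum_mul_left, ENNReal.tsum_geometric, ENNReal.one_sub_inv_two, inv_inv, pow_one,
    mul_assoc, ENNReal.inv_mul_cancel (by simp) (by simp), mul_one]

theorem step_generic {V : Set (List Bool)} (hV : Cond V) (c : OracleCode) :
    ∃ V', V ⊆ V' ∧ Cond V' ∧ ∀ A, A ∉ openOf V' → ∀ G, c.eval (chi A) = chi G →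
      ¬ OneGeneric G := by
  by_cases hT : ∀ n, mu ((openOf V)ᶜ ∩ {X | ¬ (c.eval (chi X) n).Dom}) = 0
  swap
  · push Not at hT
    obtain ⟨n, hn⟩ := hT
    set V1 : Set (List Bool) := {ρ | ∃ v, v ∈ c.eval (strOracle ρ) n} with hV1
    have hdom : ∀ X, X ∈ openOf V1 ↔ (c.eval (chi X) n).Dom := by
      intro X
      have hup : Up V1 := fun σ τ h ⟨v, hv⟩ => ⟨v, eval_str_mono c h hv⟩
      rw [mem_openOf_up hup, Part.dom_iff_mem]
      simp only [eval_chi_iff]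
      exact exists_comm
    refine ⟨V ∪ V1, Set.subset_union_left, ⟨?_, ?_, ?_⟩, ?_⟩
    · exact hV.up.union fun σ τ h ⟨v, hv⟩ => ⟨v, eval_str_mono c h hv⟩
    · refine hV.sig.or (Sig1.ex (p := fun z : List Bool × ℕ => z.2 ∈ c.eval (strOracle z.1) n) ?_)
      exact (Sig1.eval c).comp (f := fun z : List Bool × ℕ => ((z.1, n), z.2))
        ((Primrec.fst.pair (Primrec.const n)).pair Primrec.snd)
    · refine fun h => hn (measure_mono_null ?_ h)
      rintro X ⟨h1, h2⟩ hX
      rw [openOf_union] at hX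
      exact hX.elim h1 fun h => h2 ((hdom X).1 h)
    · intro A hA G hG
      exfalso
      apply hA
      rw [openOf_union]
      right
      rw [hdom, hG]
      trivial
  obtain ⟨e, he⟩ : ∃ e : ℕ, (2⁻¹ : ℝ≥0∞) ^ e < mu (openOf V)ᶜ :=
    ((ENNReal.tendsto_pow_atTop_nhds_zero_of_lt_one (by simp)).eventually_lt_const
      (pos_iff_ne_zero.2 hV.pos)).exists
  have hp : Sig1 (fun z : List Bool × List Bool =>
      (∃ t, z.1 ++ t = z.2) ∧ Small (Bad c V z.2) (e + 1 + Encodable.encode z.1)) := by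
    refine Sig1.and ?_ ?_
    · exact Sig1.ex (p := fun y : (List Bool × List Bool) × List Bool => y.1.1 ++ y.2 = y.1.2)
        (Sig1.of_prim (Primrec.eq.comp (Primrec.list_append.comp (Primrec.fst.comp Primrec.fst)
          Primrec.snd) (Primrec.snd.comp Primrec.fst)))
    · refine small_sig1 (B := fun z : List Bool × List Bool => Bad c V z.2)
        ((Bad.sig c hV.sig).comp
          (f := fun y : (List Bool × List Bool) × List Bool => (y.1.2, y.2)) ?_) ?_
      · exact (Primrec.snd.comp Primrec.fst).pair Primrec.snd
      · exact Primrec.nat_add.comp (Primrec.const (e + 1)) (Primrec.encode.comp Primrec.fst)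
  obtain ⟨q, hq, hqp, hqt, hqu⟩ := hp.unif
  have hqt' : ∀ σ, ∃ τ, q (σ, τ) := by
    intro σ
    obtain ⟨τ, h1, h2⟩ := bad_dense c hT σ (e + 1 + Encodable.encode σ)
    exact hqt σ ⟨τ, h1, Small.of_measure (Bad.up c hV.up τ) _ h2⟩
  choose t ht using hqt'
  set D : Set (List Bool) := {τ | ∃ σ, q (σ, τ)} with hD
  have hDs : Sig1 (fun τ => τ ∈ D) :=
    Sig1.ex (hq.comp (f := fun z : List Bool × List Bool => (z.2, z.1))
      (Primrec.snd.pair Primrec.fst))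
  set V1 : Set (List Bool) := {ρ | ∃ τ, τ ∈ D ∧ ∀ i ∈ List.range τ.length, ∃ b : Bool,
    τ[i]? = some b ∧ cond b 1 0 ∈ c.eval (strOracle ρ) i} with hV1
  have hV1s : Sig1 (fun ρ => ρ ∈ V1) := by
    have h1 : Sig1 (fun z : ((List Bool × List Bool) × ℕ) × Bool =>
        z.1.1.2[z.1.2]? = some z.2 ∧ cond z.2 1 0 ∈ c.eval (strOracle z.1.1.1) z.1.2) := by
      refine Sig1.and (Sig1.of_prim ?_) ?_
      · exact Primrec.eq.comp (Primrec.list_getElem?.comp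
          (Primrec.snd.comp (Primrec.fst.comp Primrec.fst)) (Primrec.snd.comp Primrec.fst))
          (Primrec.option_some.comp Primrec.snd)
      · exact (Sig1.eval c).comp (f := fun z : ((List Bool × List Bool) × ℕ) × Bool =>
          ((z.1.1.1, z.1.2), cond z.2 1 0))
          (((Primrec.fst.comp (Primrec.fst.comp Primrec.fst)).pair
            (Primrec.snd.comp Primrec.fst)).pair (cond_primrec.comp Primrec.snd))
    have h2 := h1.ex.ball (f := fun z : List Bool × List Bool => List.range z.2.length)
      (Primrec.list_range.comp (Primrec.list_length.comp Primrec.snd))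
    exact ((hDs.comp Primrec.snd).and h2).ex
  refine ⟨V ∪ V1, Set.subset_union_left, ⟨?_, hV.sig.or hV1s, ?_⟩, ?_⟩
  · refine hV.up.union ?_
    rintro ρ ρ' h ⟨τ, hτ, hρ⟩
    refine ⟨τ, hτ, fun i hi => ?_⟩
    obtain ⟨b, h1, h2⟩ := hρ i hi
    exact ⟨b, h1, eval_str_mono c h h2⟩
  · intro h0
    have h1 : (openOf V)ᶜ ⊆ (openOf (V ∪ V1))ᶜ ∪ ⋃ σ, (openOf (Bad c V (t σ)))ᶜ := by
      intro X hX
      by_cases hX1 : X ∈ openOf (V ∪ V1)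
      swap
      · exact Or.inl hX1
      right
      rw [openOf_union] at hX1
      obtain ⟨ρ, ⟨τ, ⟨σ, hτ⟩, hρ⟩, hXρ⟩ := hX1.resolve_left hX
      refine Set.mem_iUnion.2 ⟨σ, ?_⟩
      obtain rfl := hqu σ _ _ hτ (ht σ)
      intro hbad
      unfold Bad at hbad
      rw [openOf_union] at hbad
      obtain ⟨ρ', ⟨i, b, v, hb, hv, hne⟩, hXρ'⟩ := hbad.resolve_left hX
      have hi : i < (t σ).length := by
        by_contra hi
        rw [List.getElem?_eq_none (not_lt.1 hi)] at hb
        exact absurd hb (by simp)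
      obtain ⟨b', hb', hv'⟩ := hρ i (List.mem_range.2 hi)
      rw [hb] at hb'
      obtain rfl := Option.some.inj hb'
      have e1 : v ∈ c.eval (chi X) i :=
        (eval_chi_iff c X i v).2 ⟨ρ'.length, by rwa [(extendsStr_iff _ _).1 hXρ']⟩
      have e2 : cond b 1 0 ∈ c.eval (chi X) i :=
        (eval_chi_iff c X i _).2 ⟨ρ.length, by rwa [(extendsStr_iff _ _).1 hXρ]⟩
      exact hne (Part.mem_unique e1 e2)
    have h2 := (measure_mono h1).trans (measure_union_le (μ := mu) _ _)
    rw [h0, zero_add] at h2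
    have h3 := (h2.trans (measure_iUnion_le _)).trans
      (ENNReal.tsum_le_tsum fun σ => Small.measure _ (hqp _ (ht σ)).2)
    exact absurd he (not_lt.2 (h3.trans (tsum_strings_le e)))
  · intro A hA G hG hgen
    obtain ⟨σ, hσG, hσ⟩ := hgen D hDs.ce
    rcases hσ with hσ | hσ
    swap
    · exact hσ (t σ) (hqp _ (ht σ)).1 ⟨σ, ht σ⟩
    apply hA
    rw [openOf_union]
    right
    have key : ∀ i, ∃ m, cond (G i) 1 0 ∈ c.eval (strOracle (pre A m)) i := by
      intro i
      rw [← eval_chi_iff, hG]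
      exact Part.mem_some _
    choose m hm using key
    refine ⟨pre A ((Finset.range σ.length).sup m), ⟨σ, hσ, fun i hi => ?_⟩,
      extends_of_pre A List.prefix_rfl⟩
    have hi' := List.mem_range.1 hi
    refine ⟨G i, ?_, eval_str_mono c (pre_mono A (Finset.le_sup (f := m)
      (Finset.mem_range.2 hi'))) (hm i)⟩
    have := hσG ⟨i, hi'⟩
    simp only at this
    rw [this]
    simp [hi']

theorem encodeCode_injective : Function.Injective OracleCode.encodeCode := by
  intro a
  induction a with
  | zero => intro b h; cases b <;> simp [OracleCode.encodeCode] at h ⊢ <;> omega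
  | succ => intro b h; cases b <;> simp [OracleCode.encodeCode] at h ⊢ <;> omega
  | left => intro b h; cases b <;> simp [OracleCode.encodeCode] at h ⊢ <;> omega
  | right => intro b h; cases b <;> simp [OracleCode.encodeCode] at h ⊢ <;> omega
  | oracle => intro b h; cases b <;> simp [OracleCode.encodeCode] at h ⊢ <;> omega
  | pair f g hf hg =>
    intro b h
    cases b <;> simp only [OracleCode.encodeCode] at h <;> try omega
    rename_i f' g'
    have h' := Nat.pair_eq_pair.1 (show Nat.pair f.encodeCode g.encodeCode =
      Nat.pair f'.encodeCode g'.encodeCode by omega)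
    rw [hf h'.1, hg h'.2]
  | comp f g hf hg =>
    intro b h
    cases b <;> simp only [OracleCode.encodeCode] at h <;> try omega
    rename_i f' g'
    have h' := Nat.pair_eq_pair.1 (show Nat.pair f.encodeCode g.encodeCode =
      Nat.pair f'.encodeCode g'.encodeCode by omega)
    rw [hf h'.1, hg h'.2]
  | prec f g hf hg =>
    intro b h
    cases b <;> simp only [OracleCode.encodeCode] at h <;> try omega
    rename_i f' g'
    have h' := Nat.pair_eq_pair.1 (show Nat.pair f.encodeCode g.encodeCode =
      Nat.pair f'.encodeCode g'.encodeCode by omega)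
    rw [hf h'.1, hg h'.2]
  | rfind' f hf =>
    intro b h
    cases b <;> simp only [OracleCode.encodeCode] at h <;> try omega
    rename_i f'
    have h' := Nat.pair_eq_pair.1 (show Nat.pair f.encodeCode f.encodeCode =
      Nat.pair f'.encodeCode f'.encodeCode by omega)
    rw [hf h'.1]

/-- what a condition should decide about the code `c` -/
def Meets (V : Set (List Bool)) (c : OracleCode) : Prop :=
  ∀ A, A ∉ openOf V →
    (∀ U : ℕ → Set (List Bool), (∀ (i : ℕ) (σ : List Bool), σ ∈ U i ↔
      (c.eval (chi fun _ => false) (Nat.pair i (Encodable.encode σ))).Dom) →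
      cantorMeasure (⋂ i, openOf (U i)) = 0 → A ∉ ⋂ i, openOf (U i)) ∧
    ∀ G, c.eval (chi A) = chi G → ¬ OneGeneric G

theorem step_s9 {V : Set (List Bool)} (hV : Cond V) (c : OracleCode) :
    ∃ V', V ⊆ V' ∧ Cond V' ∧ Meets V' c := by
  obtain ⟨V1, h1, hV1, hg⟩ := step_generic hV c
  set U : ℕ → Set (List Bool) := fun i => {σ |
    (c.eval (chi fun _ => false) (Nat.pair i (Encodable.encode σ))).Dom} with hU
  have hUeq : ∀ U' : ℕ → Set (List Bool), (∀ (i : ℕ) (σ : List Bool), σ ∈ U' i ↔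
      (c.eval (chi fun _ => false) (Nat.pair i (Encodable.encode σ))).Dom) → U' = U := by
    intro U' h
    funext i
    ext σ
    exact h i σ
  by_cases h0 : cantorMeasure (⋂ i, openOf (U i)) = 0
  · have h0' : mu (⋂ i, openOf (U i)) = 0 := le_antisymm (h0 ▸ mu_le_cantorMeasure _) zero_le
    obtain ⟨V2, h2, hV2, hr⟩ := step_random hV1 ⟨c, fun i σ => Iff.rfl⟩ h0'
    refine ⟨V2, h1.trans h2, hV2, fun A hA => ⟨fun U' hU' _ => ?_,
      hg A fun h => hA (openOf_mono h2 h)⟩⟩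
    rw [hUeq U' hU']
    exact hr A hA
  · refine ⟨V1, h1, hV1, fun A hA => ⟨fun U' hU' h => ?_, hg A hA⟩⟩
    rw [hUeq U' hU'] at h
    exact absurd h h0

theorem cond_empty : Cond ∅ where
  up := fun _ _ _ h => h
  sig := ⟨fun _ _ => False, Primrec.primrecPred (Primrec.const false), by simp⟩
  pos := by
    have : openOf ∅ = ∅ := by ext X; simp [openOf]
    simp [this]

theorem main_exists : ∃ A : ℕ → Bool, ∀ c : OracleCode, ∃ V, Meets V c ∧ A ∉ openOf V := by
  have : Countable OracleCode := encodeCode_injective.countable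
  have : Nonempty OracleCode := ⟨.zero⟩
  obtain ⟨en, hen⟩ := exists_surjective_nat OracleCode
  choose f hf1 hf2 hf3 using fun (V : {V // Cond V}) (c : OracleCode) => step_s9 V.2 c
  let s : ℕ → {V // Cond V} := fun n =>
    Nat.rec ⟨∅, cond_empty⟩ (fun k V => ⟨f V (en k), hf2 V (en k)⟩) n
  have hs : ∀ n, (s (n + 1)).1 = f (s n) (en n) := fun n => rfl
  have hne : (⋂ n, (openOf (s n).1)ᶜ).Nonempty := by
    refine IsCompact.nonempty_iInter_of_sequence_nonempty_isCompact_isClosed _ ?_ ?_ ?_ ?_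
    · intro n
      refine Set.compl_subset_compl.2 (openOf_mono ?_)
      rw [hs]
      exact hf1 _ _
    · intro n
      exact nonempty_of_measure_ne_zero (s n).2.pos
    · exact (isOpen_openOf _).isClosed_compl.isCompact
    · exact fun n => (isOpen_openOf _).isClosed_compl
  obtain ⟨A, hA⟩ := hne
  refine ⟨A, fun c => ?_⟩
  obtain ⟨n, rfl⟩ := hen c
  exact ⟨_, hf3 (s n) (en n), Set.mem_iInter.1 hA (n + 1)⟩

/-- there is a weakly 2-random Turing degree which does not bound
any 1-generic Turing degree. -/
theorem weak2Random_not_bounding_oneGeneric :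
    ∃ A : ℕ → Bool, Weak2Random A ∧
      ∀ G : ℕ → Bool, OneGeneric G → ¬ TRed G A := by
  obtain ⟨A, hA⟩ := main_exists
  refine ⟨A, ?_, ?_⟩
  · rintro V ⟨c, hc⟩ h0
    obtain ⟨W, hW, hAW⟩ := hA c
    exact (hW A hAW).1 V hc h0
  · rintro G hG ⟨c, hc⟩
    obtain ⟨W, hW, hAW⟩ := hA c
    exact (hW A hAW).2 G hc hG

end TypicalDegree
end
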